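/- Let f be a non wandering positive twist map of the closed annulus A = 𝕋 × [0,1] and let U ⊆ A be an f-invariant lower disk. Then U is regular and its frontier meets each vertical segment {x}×[0,1], x ∈ 𝕋, in at most one point. -/

import Mathlib

open Set Filter Topology MeasureTheory

noncomputable section

/-- The circle `𝕋 = ℝ/ℤ`. -/
abbrev 𝕋 : Type := AddCircle (1 : ℝ)

/-- The closed annulus `A = 𝕋 × [0,1]`. -/
abbrev Ann : Type := 𝕋 × ↥(Set.Icc (0:ℝ) 1)

/-- The universal cover `Ã = ℝ × [0,1]`. -/
abbrev StripA : Type := ℝ × ↥(Set.Icc (0:ℝ) 1)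

/-- The covering projection `π : Ã → A`. -/
def annProj : StripA → Ann := fun z => ((z.1 : 𝕋), z.2)

/-- The deck translation `T(x̃,y) = (x̃+1,y)`. -/
def deckT : StripA → StripA := fun z => (z.1 + 1, z.2)

/-- The iterated deck translation `T^p`, `p ∈ ℤ`. -/
def deckZ (p : ℤ) : StripA → StripA := fun z => (z.1 + (p : ℝ), z.2)

/-- The boundary circle `C₀ = 𝕋 × {0}`. -/
def C0 : Set Ann := {z | (z.2 : ℝ) = 0}

/-- The boundary circle `C₁ = 𝕋 × {1}`. -/
def C1 : Set Ann := {z | (z.2 : ℝ) = 1}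

/-- A point of `Ã` on the boundary line `ℝ × {0}`. -/
def bd0 (x : ℝ) : StripA := (x, ⟨0, by norm_num⟩)

/-- A point of `Ã` on the boundary line `ℝ × {1}`. -/
def bd1 (x : ℝ) : StripA := (x, ⟨1, by norm_num⟩)

/-- A homeomorphism of the closed annulus isotopic to the identity, together with a
chosen lift to the universal cover.  (A homeomorphism of `A` is isotopic to the identity
iff it admits a lift commuting with the deck translation and preserving each boundary
line of the strip.) -/
structure AnnulusHomeo where
  toFun : Ann ≃ₜ Ann
  lift : StripA ≃ₜ StripA
  lift_proj : ∀ z : StripA, annProj (lift z) = toFun (annProj z)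
  lift_deck : ∀ z : StripA, lift (deckT z) = deckT (lift z)
  lift_bd0 : ∀ z : StripA, (z.2 : ℝ) = 0 → ((lift z).2 : ℝ) = 0

/-- The iterate `f^k`, `k ∈ ℤ`. -/
def AnnulusHomeo.iter (h : AnnulusHomeo) (k : ℤ) : Ann → Ann :=
  fun z => ((h.toFun.toEquiv : Equiv.Perm Ann) ^ k) z

/-- The iterate `f̃^k` of the lift, `k ∈ ℤ`. -/
def AnnulusHomeo.liftIter (h : AnnulusHomeo) (k : ℤ) : StripA → StripA :=
  fun z => ((h.lift.toEquiv : Equiv.Perm StripA) ^ k) z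

/-- `f` is non wandering: every nonempty open set meets one of its forward iterates. -/
def NonWandering (h : AnnulusHomeo) : Prop :=
  ∀ U : Set Ann, IsOpen U → U.Nonempty → ∃ k : ℕ, 0 < k ∧ (h.iter k '' U ∩ U).Nonempty

/-- The closed strip `ℝ × [0,1]` inside the plane. -/
def stripS : Set (ℝ × ℝ) := {p | p.2 ∈ Set.Icc (0:ℝ) 1}

/-- A positive twist map: a `C¹` diffeomorphism of the annulus, isotopic to the identity,
whose lift `F` to the strip (together with its inverse `G`) is continuously differentiable
and satisfies `∂(p̃₁ ∘ f̃)/∂y > 0`, i.e. the first component of `DF(z)·(0,1)` is positive. -/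
structure PositiveTwistMap extends AnnulusHomeo where
  F : ℝ × ℝ → ℝ × ℝ
  F' : ℝ × ℝ → (ℝ × ℝ) →L[ℝ] (ℝ × ℝ)
  G : ℝ × ℝ → ℝ × ℝ
  G' : ℝ × ℝ → (ℝ × ℝ) →L[ℝ] (ℝ × ℝ)
  F_lift : ∀ z : StripA, F (z.1, (z.2 : ℝ)) = ((lift z).1, ((lift z).2 : ℝ))
  G_lift : ∀ z : StripA, G (z.1, (z.2 : ℝ)) = ((lift.symm z).1, ((lift.symm z).2 : ℝ))
  F_hasDeriv : ∀ z ∈ stripS, HasFDerivWithinAt F (F' z) stripS z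
  G_hasDeriv : ∀ z ∈ stripS, HasFDerivWithinAt G (G' z) stripS z
  F'_cont : ContinuousOn F' stripS
  G'_cont : ContinuousOn G' stripS
  twist_pos : ∀ z ∈ stripS, 0 < (F' z (0, 1)).1

/-- The oriented angle (in `(-π, π]`) from the vertical vector `(0,1)` to the vector `w`. -/
def angleFromVertical (w : ℝ × ℝ) : ℝ := Complex.arg ⟨w.2, -w.1⟩

/-- `ρ` is the rotation number of `f` on the boundary circle `C₀`, computed with the lift. -/
def HasRotNum0 (h : AnnulusHomeo) (ρ : ℝ) : Prop :=
  ∀ x : ℝ, Tendsto (fun n : ℕ => ((h.liftIter (n : ℤ) (bd0 x)).1 - x) / (n : ℝ))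
    atTop (𝓝 ρ)

/-- `ρ` is the rotation number of `f` on the boundary circle `C₁`, computed with the lift. -/
def HasRotNum1 (h : AnnulusHomeo) (ρ : ℝ) : Prop :=
  ∀ x : ℝ, Tendsto (fun n : ℕ => ((h.liftIter (n : ℤ) (bd1 x)).1 - x) / (n : ℝ))
    atTop (𝓝 ρ)

/-- A closed `f`-invariant set `X ⊆ A` is well ordered if the first projection is injective
on `X` and the lift preserves the horizontal order on `π⁻¹(X)`. -/
def IsWellOrdered (h : AnnulusHomeo) (X : Set Ann) : Prop :=
  IsClosed X ∧ h.toFun '' X = X ∧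
  Set.InjOn (fun z : Ann => z.1) X ∧
  ∀ z₁ z₂ : StripA, annProj z₁ ∈ X → annProj z₂ ∈ X → z₁.1 < z₂.1 →
    (h.lift z₁).1 < (h.lift z₂).1

/-- An essential simple loop in the annulus: the range of an injective continuous map
from the circle that is not null-homotopic. -/
def IsEssentialSimpleLoop (Γ : Set Ann) : Prop :=
  ∃ γ : C(𝕋, Ann), Function.Injective γ ∧ ¬ γ.Nullhomotopic ∧ Set.range γ = Γ

/-- `Γ` meets each vertical segment `{x} × [0,1]` in exactly one point. -/
def MeetsVerticalsOnce (Γ : Set Ann) : Prop :=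
  ∀ x : 𝕋, ∃! z : Ann, z ∈ Γ ∧ z.1 = x

/-- No essential simple loop meeting each vertical segment exactly once is invariant,
except the two boundary circles. -/
def NoInvariantTransverseLoop (h : AnnulusHomeo) : Prop :=
  ∀ Γ : Set Ann, IsEssentialSimpleLoop Γ → MeetsVerticalsOnce Γ →
    h.toFun '' Γ = Γ → Γ = C0 ∨ Γ = C1

/-- A continuum: a nonempty compact connected set. -/
def IsContinuum (X : Set Ann) : Prop := X.Nonempty ∧ IsCompact X ∧ IsPreconnected X

/-- A lower annulus: an open set homeomorphic to `𝕋 × [0,1)` containing `C₀`. -/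
def IsLowerAnnulus (U : Set Ann) : Prop :=
  IsOpen U ∧ Nonempty (↥U ≃ₜ (𝕋 × ↥(Set.Ico (0:ℝ) 1))) ∧ C0 ⊆ U

/-- A lower disk: an open set homeomorphic to `ℝ × [0,1)` meeting `C₀`. -/
def IsLowerDisk (U : Set Ann) : Prop :=
  IsOpen U ∧ Nonempty (↥U ≃ₜ (ℝ × ↥(Set.Ico (0:ℝ) 1))) ∧ (U ∩ C0).Nonempty

/-- A lower annulus is regular if it is a connected component of the complement of an
essential simple loop. -/
def IsRegularLowerAnnulus (U : Set Ann) : Prop :=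
  ∃ Γ : Set Ann, IsEssentialSimpleLoop Γ ∧ ∃ z : Ann, U = connectedComponentIn Γᶜ z

/-- A lower disk is regular if it is a connected component of the complement of a simple
arc joining two points of `C₀` and meeting `C₀` only at its endpoints, or of the
complement of an essential simple loop meeting `C₀` in exactly one point. -/
def IsRegularLowerDisk (U : Set Ann) : Prop :=
  (∃ a : C(↥(Set.Icc (0:ℝ) 1), Ann), Function.Injective a ∧
      (∀ t : ↥(Set.Icc (0:ℝ) 1), a t ∈ C0 ↔ ((t : ℝ) = 0 ∨ (t : ℝ) = 1)) ∧
      ∃ z : Ann, U = connectedComponentIn (Set.range a)ᶜ z) ∨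
  (∃ Γ : Set Ann, IsEssentialSimpleLoop Γ ∧ (∃! z : Ann, z ∈ Γ ∩ C0) ∧
      ∃ z : Ann, U = connectedComponentIn Γᶜ z)

end

/-- Every continuous map from `X` to the circle has a continuous real-valued lift. -/
def HasCircleLifts (X : Type*) [TopologicalSpace X] : Prop :=
  ∀ g : C(X, 𝕋), ∃ G : C(X, ℝ), ∀ x, (G x : 𝕋) = g x

theorem hasCircleLifts_of_simplyConnected (X : Type*) [TopologicalSpace X]
    [SimplyConnectedSpace X] [LocallyPathConnectedSpace X] : HasCircleLifts X := by
  intro g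
  obtain ⟨x₀⟩ : Nonempty X := inferInstance
  obtain ⟨e₀, he⟩ := QuotientAddGroup.mk_surjective (g x₀)
  obtain ⟨G, ⟨-, hG⟩, -⟩ :=
    (AddCircle.isCoveringMap_coe (1 : ℝ)).existsUnique_continuousMap_lifts g x₀ e₀ he
  exact ⟨G, fun x => congrFun hG x⟩

theorem HasCircleLifts.homeomorph {X Y : Type*} [TopologicalSpace X] [TopologicalSpace Y]
    (h : HasCircleLifts X) (e : X ≃ₜ Y) : HasCircleLifts Y := by
  intro g
  obtain ⟨G, hG⟩ := h (g.comp ⟨e, e.continuous⟩)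
  exact ⟨G.comp ⟨e.symm, e.symm.continuous⟩, fun y => by simpa using hG (e.symm y)⟩

/-- A continuous function on a preconnected set taking integer values is constant. -/
theorem IsPreconnected.eq_of_circle_eq_zero {X : Type*} [TopologicalSpace X] {s : Set X}
    (hs : IsPreconnected s) {G : X → ℝ} (hG : ContinuousOn G s)
    (hz : ∀ x ∈ s, ((G x : ℝ) : 𝕋) = 0) {x y : X} (hx : x ∈ s) (hy : y ∈ s) : G x = G y := by
  have hint : ∀ x ∈ s, ∃ n : ℤ, (n : ℝ) = G x := by
    intro x hx
    obtain ⟨n, hn⟩ := (AddCircle.coe_eq_zero_iff (1 : ℝ)).1 (hz x hx)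
    exact ⟨n, by simpa using hn⟩
  have hc := hs.image G hG
  have hoc := hc.ordConnected
  by_contra hne
  wlog hlt : G x < G y generalizing x y
  · exact this hy hx (Ne.symm hne) (lt_of_le_of_ne (not_lt.1 hlt) (Ne.symm hne))
  obtain ⟨n, hn⟩ := hint x hx
  obtain ⟨m, hm⟩ := hint y hy
  rw [← hn, ← hm] at hlt
  have hnm : n + 1 ≤ m := by exact_mod_cast hlt
  have hnm' : (n : ℝ) + 1 ≤ m := by exact_mod_cast hnm
  obtain ⟨z, hz, hzz⟩ := hoc.out ⟨x, hx, rfl⟩ ⟨y, hy, rfl⟩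
    (show (n : ℝ) + 1 / 2 ∈ Icc (G x) (G y) by constructor <;> linarith)
  obtain ⟨k, hk⟩ := hint z hz
  have h2 : (2 * (k : ℝ)) = 2 * n + 1 := by rw [hk, hzz]; ring
  have h3 : 2 * k = 2 * n + 1 := by exact_mod_cast h2
  omega

/-- If two open preconnected sets cover `X`, their intersection is preconnected. -/
def IsUnicoherent (X : Type*) [TopologicalSpace X] : Prop :=
  ∀ A B : Set X, IsOpen A → IsOpen B → A ∪ B = univ → IsPreconnected A → IsPreconnected B →
    IsPreconnected (A ∩ B)

open Classical in
theorem HasCircleLifts.isUnicoherent {X : Type*} [TopologicalSpace X] [NormalSpace X]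
    (h : HasCircleLifts X) : IsUnicoherent X := by
  intro A B hA hB hAB hAc hBc
  rw [isPreconnected_iff_subset_of_disjoint]
  by_contra hcon
  push Not at hcon
  obtain ⟨u, v, hu, hv, huv, hdis, hnu, hnv⟩ := hcon
  obtain ⟨q, hq, hqu⟩ := not_subset.1 hnu
  obtain ⟨p, hp, hpv⟩ := not_subset.1 hnv
  have hpu : p ∈ u := (huv hp).resolve_right hpv
  obtain ⟨w, hw0, hw1, -⟩ := exists_continuous_zero_one_of_isClosed (s := Bᶜ) (t := Aᶜ)
    hB.isClosed_compl hA.isClosed_compl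
    (disjoint_left.2 fun x hxB hxA => by
      have : x ∈ A ∪ B := hAB ▸ mem_univ x
      exact this.elim hxA hxB)
  have hw0' : ∀ x ∉ B, w x = 0 := fun x hx => hw0 hx
  have hw1' : ∀ x ∉ A, w x = 1 := fun x hx => hw1 hx
  set P : Set X := A ∩ B ∩ u with hP
  set Q : Set X := A ∩ B ∩ v with hQ
  have hPo : IsOpen P := (hA.inter hB).inter hu
  have hQo : IsOpen Q := (hA.inter hB).inter hv
  have hPQ : ∀ x ∈ P, x ∉ Q := fun x hx hx' => by
    have : x ∈ A ∩ B ∩ (u ∩ v) := ⟨hx.1, hx.2, hx'.2⟩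
    rw [hdis] at this; exact this
  -- the two local branches
  let a : X → ℝ := fun x => if x ∈ P then w x else 0
  let b : X → ℝ := fun x => if x ∈ P then w x else 1
  have haA : ContinuousOn a A := by
    intro x hx
    apply ContinuousAt.continuousWithinAt
    by_cases hxB : x ∈ B
    · rcases huv ⟨hx, hxB⟩ with hxu | hxv
      · have : a =ᶠ[𝓝 x] w := by
          filter_upwards [hPo.mem_nhds ⟨⟨hx, hxB⟩, hxu⟩] with y hy
          simp [a, hy]
        exact (w.continuous.continuousAt).congr this.symm
      · have : a =ᶠ[𝓝 x] fun _ => 0 := by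
          filter_upwards [hQo.mem_nhds ⟨⟨hx, hxB⟩, hxv⟩] with y hy
          have : y ∉ P := fun h => hPQ y h hy
          simp [a, this]
        exact continuousAt_const.congr this.symm
    · have h0 : a x = 0 := by
        have : x ∉ P := fun h => hxB h.1.2
        simp [a, this]
      rw [ContinuousAt, h0]
      have hwx := w.continuous.tendsto x
      rw [hw0' x hxB] at hwx
      have hwx' := hwx.abs
      rw [abs_zero] at hwx'
      refine squeeze_zero_norm (fun y => ?_) hwx'
      by_cases hy : y ∈ P <;> simp [a, hy]
  have hbB : ContinuousOn b B := by
    intro x hx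
    apply ContinuousAt.continuousWithinAt
    by_cases hxA : x ∈ A
    · rcases huv ⟨hxA, hx⟩ with hxu | hxv
      · have : b =ᶠ[𝓝 x] w := by
          filter_upwards [hPo.mem_nhds ⟨⟨hxA, hx⟩, hxu⟩] with y hy
          simp [b, hy]
        exact (w.continuous.continuousAt).congr this.symm
      · have : b =ᶠ[𝓝 x] fun _ => 1 := by
          filter_upwards [hQo.mem_nhds ⟨⟨hxA, hx⟩, hxv⟩] with y hy
          have : y ∉ P := fun h => hPQ y h hy
          simp [b, this]
        exact continuousAt_const.congr this.symm
    · have h0 : b x = 1 := by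
        have : x ∉ P := fun h => hxA h.1.1
        simp [b, this]
      rw [ContinuousAt, h0, tendsto_iff_norm_sub_tendsto_zero]
      have hwx := w.continuous.tendsto x
      rw [hw1' x hxA, tendsto_iff_norm_sub_tendsto_zero] at hwx
      refine squeeze_zero_norm (fun y => ?_) hwx
      by_cases hy : y ∈ P <;> simp [b, hy]
  have hab : ∀ x, ((a x : ℝ) : 𝕋) = (b x : ℝ) := by
    intro x
    by_cases hx : x ∈ P
    · simp [a, b, hx]
    · have : ((1 : ℝ) : 𝕋) = 0 := AddCircle.coe_period 1
      simp [a, b, hx, this]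
  have hg : Continuous fun x => ((a x : ℝ) : 𝕋) := by
    rw [continuous_iff_continuousAt]
    intro x
    have hc : Continuous ((↑) : ℝ → 𝕋) := AddCircle.continuous_mk' 1
    rcases (hAB ▸ mem_univ x : x ∈ A ∪ B) with hx | hx
    · exact hc.continuousAt.comp (haA.continuousAt (hA.mem_nhds hx))
    · have : (fun x => ((a x : ℝ) : 𝕋)) = fun x => ((b x : ℝ) : 𝕋) := funext hab
      rw [this]
      exact hc.continuousAt.comp (hbB.continuousAt (hB.mem_nhds hx))
  obtain ⟨G, hG⟩ := h ⟨_, hg⟩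
  have hG' : ∀ x, (G x : 𝕋) = a x := hG
  have h1 := hAc.eq_of_circle_eq_zero (G := fun x => G x - a x)
    (G.continuous.continuousOn.sub haA) (fun x _ => by
      rw [AddCircle.coe_sub, hG', sub_self]) hp.1 hq.1
  have h2 := hBc.eq_of_circle_eq_zero (G := fun x => G x - b x)
    (G.continuous.continuousOn.sub hbB) (fun x _ => by
      rw [AddCircle.coe_sub, hG', hab, sub_self]) hp.2 hq.2
  have hpP : p ∈ P := ⟨hp, hpu⟩
  have hqP : q ∉ P := fun h => hqu h.2
  simp only [a, b, hpP, hqP, if_true, if_false] at h1 h2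
  linarith

theorem IsUnicoherent.homeomorph {X Y : Type*} [TopologicalSpace X] [TopologicalSpace Y]
    (h : IsUnicoherent X) (e : X ≃ₜ Y) : IsUnicoherent Y := by
  intro A B hA hB hAB hAc hBc
  have := h (e ⁻¹' A) (e ⁻¹' B) (hA.preimage e.continuous) (hB.preimage e.continuous)
    (by rw [← preimage_union, hAB, preimage_univ]) (e.isPreconnected_preimage.2 hAc)
    (e.isPreconnected_preimage.2 hBc)
  rw [← preimage_inter] at this
  exact e.isPreconnected_preimage.1 this

/-- Unicoherence of an open subset, stated with subsets of the ambient space. -/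
theorem IsUnicoherent.inter_isPreconnected {X : Type*} [TopologicalSpace X] {Ω : Set X}
    (h : IsUnicoherent Ω) {A B : Set X} (hA : IsOpen A) (hB : IsOpen B) (hAB : A ∪ B = Ω)
    (hAc : IsPreconnected A) (hBc : IsPreconnected B) : IsPreconnected (A ∩ B) := by
  have key : ∀ C : Set X, C ⊆ Ω →
      (IsPreconnected ((↑) ⁻¹' C : Set Ω) ↔ IsPreconnected C) := by
    intro C hC
    rw [← Topology.IsInducing.subtypeVal.isPreconnected_image, Subtype.image_preimage_coe,
      inter_eq_right.2 hC]
  have hAΩ : A ⊆ Ω := hAB ▸ subset_union_left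
  have hBΩ : B ⊆ Ω := hAB ▸ subset_union_right
  rw [← key _ (inter_subset_left.trans hAΩ), preimage_inter]
  refine h _ _ (hA.preimage continuous_subtype_val) (hB.preimage continuous_subtype_val) ?_
    ((key A hAΩ).2 hAc) ((key B hBΩ).2 hBc)
  rw [← preimage_union, hAB, Subtype.coe_preimage_self]

theorem locallyConnectedSpace_Icc : LocallyConnectedSpace (Set.Icc (0 : ℝ) 1) := by
  have := Convex.locallyPathConnectedSpace ℝ (convex_Icc (0 : ℝ) 1)
  infer_instance

theorem locallyConnectedSpace_stripA : LocallyConnectedSpace StripA := by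
  have := locallyConnectedSpace_Icc
  infer_instance

/-- An open, unicoherent, recurrent invariant subset `Ω` of the strip, meeting the boundary
exactly in `(a, b) × {0}`, of a homeomorphism twisting verticals to the right. -/
structure TwistDisk (F : StripA ≃ₜ StripA) (Ω : Set StripA) (a b : ℝ) : Prop where
  bot : ∀ z, (F z).2 = 0 ↔ z.2 = 0
  twist : ∀ x, StrictMono fun y => (F (x, y)).1
  mono : StrictMono fun x => (F (x, 0)).1
  lt : a < b
  isOpen : IsOpen Ω
  conn : IsPreconnected Ω
  unicoh : IsUnicoherent Ω
  inv : F ⁻¹' Ω = Ω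
  bottom : ∀ x, ((x, 0) : StripA) ∈ Ω ↔ x ∈ Ioo a b
  top : ∀ x, ((x, 1) : StripA) ∉ Ω
  nw : ∀ N ⊆ Ω, IsOpen N → N.Nonempty → ∃ k : ℕ, 0 < k ∧ ∃ z ∈ N, F^[k] z ∈ N

/-- The reflection `(x, y) ↦ (-x, y)` of the strip. -/
def reflect : StripA ≃ₜ StripA := (Homeomorph.neg ℝ).prodCongr (Homeomorph.refl _)

@[simp] theorem reflect_apply (z : StripA) : reflect z = (-z.1, z.2) := rfl
@[simp] theorem reflect_symm_apply (z : StripA) : reflect.symm z = (-z.1, z.2) := rfl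

namespace TwistDisk

variable {F : StripA ≃ₜ StripA} {Ω : Set StripA} {a b : ℝ}

theorem mem_apply_iff (h : TwistDisk F Ω a b) {z : StripA} : F z ∈ Ω ↔ z ∈ Ω := by
  rw [← mem_preimage, h.inv]

theorem mem_symm_iff (h : TwistDisk F Ω a b) {z : StripA} : F.symm z ∈ Ω ↔ z ∈ Ω := by
  rw [← h.mem_apply_iff, F.apply_symm_apply]

theorem bot_symm (h : TwistDisk F Ω a b) (z : StripA) : (F.symm z).2 = 0 ↔ z.2 = 0 := by
  rw [← h.bot, F.apply_symm_apply]

theorem apply_bot (h : TwistDisk F Ω a b) (x : ℝ) : F (x, 0) = ((F (x, 0)).1, 0) :=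
  Prod.ext rfl ((h.bot _).2 rfl)

theorem symm_bot (h : TwistDisk F Ω a b) (x : ℝ) : F.symm (x, 0) = ((F.symm (x, 0)).1, 0) :=
  Prod.ext rfl ((h.bot_symm _).2 rfl)

theorem apply_symm_bot (h : TwistDisk F Ω a b) (x : ℝ) : F ((F.symm (x, 0)).1, 0) = (x, 0) := by
  rw [← h.symm_bot, F.apply_symm_apply]

theorem mono_symm (h : TwistDisk F Ω a b) : StrictMono fun x => (F.symm (x, 0)).1 := by
  intro x x' hx
  rw [← h.mono.lt_iff_lt]
  simpa only [h.apply_symm_bot] using hx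

theorem twist_symm_bot (h : TwistDisk F Ω a b) (d : ℝ) {y : Set.Icc (0 : ℝ) 1} (hy : 0 < y) :
    (F.symm (d, y)).1 < (F.symm (d, 0)).1 := by
  by_contra hle
  push Not at hle
  have hpos : 0 < (F.symm (d, y)).2 := by
    refine lt_of_le_of_ne (F.symm (d, y)).2.2.1 fun h0 => ?_
    exact hy.ne' ((h.bot_symm _).1 h0.symm)
  have h1 := h.twist (F.symm (d, y)).1 hpos
  have h2 := h.mono.monotone hle
  simp only [Prod.mk.eta, F.apply_symm_apply, h.apply_symm_bot] at h1 h2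
  linarith

theorem twist_symm (h : TwistDisk F Ω a b) (d : ℝ) : StrictAnti fun y => (F.symm (d, y)).1 := by
  have hc : Continuous fun y => -(F.symm (d, y)).1 :=
    (continuous_fst.comp (F.symm.continuous.comp (Continuous.prodMk_right d))).neg
  have hm : StrictMono fun y => -(F.symm (d, y)).1 := by
    refine hc.strictMono_of_inj_boundedOrder ?_ ?_
    · have := (h.twist_symm_bot d (y := ⊤) zero_lt_one).le
      exact neg_le_neg this
    · intro y y' hy
      have hy : (F.symm (d, y)).1 = (F.symm (d, y')).1 := neg_injective hy
      have h2 : (F.symm (d, y)).2 = (F.symm (d, y')).2 := by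
        apply (h.twist (F.symm (d, y)).1).injective
        change (F ((F.symm (d, y)).1, (F.symm (d, y)).2)).1 =
          (F ((F.symm (d, y)).1, (F.symm (d, y')).2)).1
        rw [Prod.mk.eta, hy, Prod.mk.eta, F.apply_symm_apply, F.apply_symm_apply]
      have := F.symm.injective (Prod.ext hy h2)
      exact (Prod.mk.inj this).2
  intro y y' hy
  exact neg_lt_neg_iff.1 (hm hy)

/-- The time-reversed, reflected system is again a twist disk. -/
theorem reflected (h : TwistDisk F Ω a b) :
    TwistDisk ((reflect.trans F.symm).trans reflect) (reflect ⁻¹' Ω) (-b) (-a) where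
  bot z := by simp [h.bot_symm]
  twist x := by
    intro y y' hy
    simpa using h.twist_symm (-x) hy
  mono := by
    intro x x' hx
    simpa using h.mono_symm (neg_lt_neg hx)
  lt := neg_lt_neg h.lt
  isOpen := h.isOpen.preimage reflect.continuous
  conn := reflect.isPreconnected_preimage.2 h.conn
  unicoh := by
    refine h.unicoh.homeomorph (reflect.subtype fun z => ?_)
    simp
  inv := by
    ext z
    simp [h.mem_symm_iff]
  bottom x := by
    simp only [mem_preimage, reflect_apply, h.bottom, mem_Ioo]
    constructor <;> rintro ⟨h1, h2⟩ <;> constructor <;> linarith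
  top x := by simpa using h.top (-x)
  nw N hN hNo hNe := by
    obtain ⟨k, hk, z, hz, hkz⟩ := h.nw (reflect ⁻¹' N)
      (fun z hz => by simpa using hN hz) (hNo.preimage reflect.continuous)
      (hNe.preimage reflect.surjective)
    refine ⟨k, hk, reflect (F^[k] z), hkz, ?_⟩
    have hsemi : Function.Semiconj reflect F.symm ((reflect.trans F.symm).trans reflect) := by
      intro w; simp
    rw [← (hsemi.iterate_right k) (F^[k] z)]
    have hli : Function.LeftInverse F.symm F := F.symm_apply_apply
    rw [(hli.iterate k) z]
    exact hz

theorem fix_left (h : TwistDisk F Ω a b) : F (a, 0) = (a, 0) := by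
  have hc : Continuous fun x : ℝ => (F (x, 0)).1 :=
    continuous_fst.comp (F.continuous.comp (Continuous.prodMk_left 0))
  have hmem : ∀ x, (F (x, 0)).1 ∈ Ioo a b ↔ x ∈ Ioo a b := by
    intro x
    rw [← h.bottom, ← h.apply_bot, h.mem_apply_iff, h.bottom]
  have hge : a ≤ (F (a, 0)).1 := by
    have ht : Tendsto (fun x : ℝ => (F (x, 0)).1) (𝓝[>] a) (𝓝 (F (a, 0)).1) :=
      (hc.tendsto a).mono_left nhdsWithin_le_nhds
    refine ge_of_tendsto ht ?_
    filter_upwards [Ioo_mem_nhdsGT h.lt] with x hx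
    exact ((hmem x).2 hx).1.le
  have hle : (F (a, 0)).1 ≤ a := by
    by_contra hlt
    push Not at hlt
    obtain ⟨w, hw1, hw2⟩ := exists_between (lt_min hlt h.lt)
    have hw : w ∈ Ioo a b := ⟨hw1, hw2.trans_le (min_le_right _ _)⟩
    have hx : (F.symm (w, 0)).1 ∈ Ioo a b := by
      rw [← hmem, h.apply_symm_bot]; exact hw
    have := h.mono hx.1
    simp only [h.apply_symm_bot] at this
    exact absurd (hw2.trans_le (min_le_left _ _)) (not_lt.2 this.le)
  rw [h.apply_bot, le_antisymm hle hge]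

theorem fix_right (h : TwistDisk F Ω a b) : F (b, 0) = (b, 0) := by
  have := h.reflected.fix_left
  simp only [Homeomorph.trans_apply, reflect_apply, neg_neg, Prod.mk.injEq, neg_inj] at this
  rw [← F.symm_apply_eq.1 (Prod.ext this.1 this.2 : F.symm (b, 0) = (b, 0))]

/-- No open set can leave a forward invariant subset in one step. -/
theorem not_wandering (h : TwistDisk F Ω a b) {E N : Set StripA} (hE : MapsTo F E E)
    (hN : IsOpen N) (hNE : N ⊆ E) (hNΩ : N ⊆ Ω) (hd : ∀ z ∈ E, F z ∉ N) : N = ∅ := by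
  by_contra hne
  obtain ⟨k, hk, z, hz, hkz⟩ := h.nw N hNΩ hN (nonempty_iff_ne_empty.2 hne)
  obtain ⟨m, rfl⟩ := Nat.exists_eq_succ_of_ne_zero hk.ne'
  rw [Function.iterate_succ_apply'] at hkz
  exact hd _ (hE.iterate m (hNE hz)) hkz

theorem lt_right (h : TwistDisk F Ω a b) {z : StripA} (hz : z ∈ Ω) : z.1 < b := by
  by_contra hzb
  push Not at hzb
  have hm : (((a + b) / 2, 0) : StripA) ∈ Ω := (h.bottom _).2 ⟨by linarith [h.lt], by linarith [h.lt]⟩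
  obtain ⟨w, hw, hwb⟩ := h.conn.intermediate_value hm hz continuous_fst.continuousOn
    (show b ∈ Icc _ _ from ⟨by linarith [h.lt], hzb⟩)
  have hH : ∀ v : StripA, b ≤ v.1 → b ≤ (F v).1 := by
    rintro ⟨x, y⟩ hx
    have h1 := (h.twist x).monotone (show (0 : Set.Icc (0 : ℝ) 1) ≤ y from y.2.1)
    have h2 := h.mono.monotone hx
    simp only [h.fix_right] at h1 h2
    linarith
  have hw2 : 0 < w.2 := by
    refine lt_of_le_of_ne w.2.2.1 fun h0 => ?_
    have : w = (b, 0) := Prod.ext hwb h0.symm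
    rw [this, h.bottom] at hw
    exact lt_irrefl _ hw.2
  have hws : (F.symm w).1 < b := by
    have h1 := h.twist_symm_bot b hw2
    rw [F.symm_apply_eq.2 h.fix_right.symm] at h1
    have hw' : w = (b, w.2) := Prod.ext hwb rfl
    rwa [← hw'] at h1
  let N : Set StripA := Ω ∩ {v | b < v.1} ∩ F.symm ⁻¹' {v | v.1 < b}
  have hN : IsOpen N := (h.isOpen.inter (isOpen_lt continuous_const continuous_fst)).inter
    ((isOpen_lt continuous_fst continuous_const).preimage F.symm.continuous)
  have hNe : N = ∅ := by
    refine h.not_wandering (E := {v | b ≤ v.1}) (fun v hv => hH v hv) hN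
      (fun v hv => le_of_lt (show b < v.1 from hv.1.2)) (fun v hv => hv.1.1) fun v hv hv' => ?_
    have := hv'.2
    simp only [mem_preimage, F.symm_apply_apply, mem_ofPred_eq] at this hv
    linarith
  have hev : ∀ᶠ v in 𝓝 w, v ∈ Ω ∧ (F.symm v).1 < b :=
    (h.isOpen.eventually_mem hw).and
      (((isOpen_lt continuous_fst continuous_const).preimage F.symm.continuous).eventually_mem hws)
  have ht : Tendsto (fun x : ℝ => ((x, w.2) : StripA)) (𝓝[>] b) (𝓝 w) := by
    have : Tendsto (fun x : ℝ => ((x, w.2) : StripA)) (𝓝 b) (𝓝 (b, w.2)) :=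
      (Continuous.prodMk_left w.2).tendsto b
    rw [← hwb, Prod.mk.eta, hwb] at this
    exact this.mono_left nhdsWithin_le_nhds
  obtain ⟨x, hx, hxb⟩ := ((ht.eventually hev).and self_mem_nhdsWithin).exists
  have : ((x, w.2) : StripA) ∈ N := ⟨⟨hx.1, hxb⟩, hx.2⟩
  rw [hNe] at this
  exact this

theorem left_lt (h : TwistDisk F Ω a b) {z : StripA} (hz : z ∈ Ω) : a < z.1 := by
  have := h.reflected.lt_right (z := reflect z) (by simpa using hz)
  simpa using this

end TwistDisk

section Components

variable {X : Type*} [TopologicalSpace X]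

theorem IsPreconnected.subset_connectedComponentIn_of_mem {T G : Set X} {x p : X}
    (hT : IsPreconnected T) (hTG : T ⊆ G) (hp : p ∈ T) (hpx : p ∈ _root_.connectedComponentIn G x) :
    T ⊆ _root_.connectedComponentIn G x := by
  rw [connectedComponentIn_eq hpx]
  exact hT.subset_connectedComponentIn hp hTG

theorem mem_connectedComponentIn_of_closure [LocallyConnectedSpace X] {G : Set X}
    (hG : IsOpen G) {x z : X} (hz : z ∈ closure (connectedComponentIn G x)) (hzG : z ∈ G) :
    z ∈ connectedComponentIn G x := by
  obtain ⟨w, hw, hwx⟩ := mem_closure_iff.1 hz _ hG.connectedComponentIn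
    (mem_connectedComponentIn hzG)
  rw [connectedComponentIn_eq hwx, ← connectedComponentIn_eq hw]
  exact mem_connectedComponentIn hzG

theorem IsPreconnected.exists_mem_closure_diff {s u : Set X} (hs : IsPreconnected s)
    (hu : IsOpen u) (hsu : (s ∩ u).Nonempty) (h : ¬ s ⊆ u) : ∃ z ∈ s, z ∈ closure u ∧ z ∉ u := by
  by_contra! hcon
  exact h (hs.subset_of_closure_inter_subset hu hsu fun z hz => hcon z hz.2 hz.1)

end Components

theorem eventually_horizontal_mem {N : Set StripA} (hN : IsOpen N) {w : StripA} (hw : w ∈ N) :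
    ∀ᶠ x in 𝓝 w.1, ((x, w.2) : StripA) ∈ N :=
  ((Continuous.prodMk_left w.2).tendsto w.1).eventually (hN.eventually_mem hw)

/-- The part of the vertical over `c` which lies in `Ω` together with everything below it. -/
def colV (Ω : Set StripA) (c : ℝ) : Set StripA := {z | z.1 = c ∧ ∀ y ≤ z.2, ((c, y) : StripA) ∈ Ω}

/-- The component of `Ω \ colV Ω c` to the left of the cut. -/
def cutL (Ω : Set StripA) (a c : ℝ) : Set StripA :=
  connectedComponentIn (Ω \ colV Ω c) ((a + c) / 2, 0)

/-- The component of `Ω \ colV Ω c` to the right of the cut. -/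
def cutR (Ω : Set StripA) (b c : ℝ) : Set StripA :=
  connectedComponentIn (Ω \ colV Ω c) ((c + b) / 2, 0)

/-- The component of `Ω ∩ {x < c}` containing the bottom interval `(a, c)`. -/
def sideL (Ω : Set StripA) (a c : ℝ) : Set StripA :=
  connectedComponentIn (Ω ∩ {z | z.1 < c}) ((a + c) / 2, 0)

/-- The part of `Ω` reached from the left of the cut by passing above it. -/
def overhang (Ω : Set StripA) (a c : ℝ) : Set StripA := cutL Ω a c \ closure (sideL Ω a c)

namespace TwistDisk

variable {F : StripA ≃ₜ StripA} {Ω : Set StripA} {a b c : ℝ}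

theorem exists_height (h : TwistDisk F Ω a b) (c : ℝ) :
    ∃ t : Set.Icc (0 : ℝ) 1, ((c, t) : StripA) ∉ Ω ∧ ∀ y < t, ((c, y) : StripA) ∈ Ω := by
  have hcl : IsCompact {y : Set.Icc (0 : ℝ) 1 | ((c, y) : StripA) ∉ Ω} :=
    (h.isOpen.isClosed_compl.preimage (Continuous.prodMk_right c)).isCompact
  obtain ⟨t, ht, hmin⟩ := hcl.exists_isLeast ⟨1, h.top c⟩
  refine ⟨t, ht, fun y hy => ?_⟩
  by_contra hn
  exact absurd (hmin hn) (not_le.2 hy)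

/-- The height at which the vertical over `c` first leaves `Ω`. -/
noncomputable def height (h : TwistDisk F Ω a b) (c : ℝ) : Set.Icc (0 : ℝ) 1 := (h.exists_height c).choose

theorem height_notMem (h : TwistDisk F Ω a b) (c : ℝ) : ((c, h.height c) : StripA) ∉ Ω :=
  (h.exists_height c).choose_spec.1

theorem mem_of_lt_height (h : TwistDisk F Ω a b) {y : Set.Icc (0 : ℝ) 1} (hy : y < h.height c) :
    ((c, y) : StripA) ∈ Ω :=
  (h.exists_height c).choose_spec.2 y hy

theorem mem_colV (h : TwistDisk F Ω a b) {z : StripA} :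
    z ∈ colV Ω c ↔ z.1 = c ∧ z.2 < h.height c := by
  refine and_congr_right fun _ => ⟨fun H => ?_, fun H y hy => h.mem_of_lt_height (hy.trans_lt H)⟩
  by_contra hn
  exact h.height_notMem c (H _ (not_lt.1 hn))

theorem height_pos (h : TwistDisk F Ω a b) (hc : c ∈ Ioo a b) : 0 < h.height c := by
  refine lt_of_le_of_ne (h.height c).2.1 fun h0 => h.height_notMem c ?_
  rw [← h0]
  exact (h.bottom c).2 hc

theorem bottom_mem_colV (h : TwistDisk F Ω a b) (hc : c ∈ Ioo a b) : ((c, 0) : StripA) ∈ colV Ω c :=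
  h.mem_colV.2 ⟨rfl, h.height_pos hc⟩

theorem colV_subset (z : StripA) (hz : z ∈ colV Ω c) : z ∈ Ω := by
  have := hz.2 z.2 le_rfl
  rwa [← hz.1] at this

theorem colV_eq (h : TwistDisk F Ω a b) : colV Ω c = {c} ×ˢ Iio (h.height c) := by
  ext z
  rw [h.mem_colV]
  rfl

theorem isPreconnected_colV (h : TwistDisk F Ω a b) : IsPreconnected (colV Ω c) := by
  rw [h.colV_eq]
  exact isPreconnected_singleton.prod isPreconnected_Iio

theorem isOpen_diff (h : TwistDisk F Ω a b) : IsOpen (Ω \ colV Ω c) := by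
  have : Ω \ colV Ω c = Ω \ ({c} ×ˢ Iic (h.height c)) := by
    ext z
    refine and_congr_right fun hz => not_congr ?_
    rw [h.mem_colV, mem_prod, mem_singleton_iff, mem_Iic]
    refine and_congr_right fun hc => ⟨le_of_lt, fun hle => lt_of_le_of_ne hle fun he => ?_⟩
    apply h.height_notMem c
    rwa [← he, ← hc]
  rw [this]
  exact h.isOpen.sdiff (isClosed_singleton.prod isClosed_Iic)

theorem isOpen_left (h : TwistDisk F Ω a b) : IsOpen (Ω ∩ {z | z.1 < c}) :=
  h.isOpen.inter (isOpen_lt continuous_fst continuous_const)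

theorem isOpen_cutL (h : TwistDisk F Ω a b) : IsOpen (cutL Ω a c) :=
  have := locallyConnectedSpace_stripA
  h.isOpen_diff.connectedComponentIn

theorem isOpen_sideL (h : TwistDisk F Ω a b) : IsOpen (sideL Ω a c) :=
  have := locallyConnectedSpace_stripA
  h.isOpen_left.connectedComponentIn

theorem isOpen_overhang (h : TwistDisk F Ω a b) : IsOpen (overhang Ω a c) :=
  h.isOpen_cutL.sdiff isClosed_closure

theorem cutL_subset {z : StripA} (hz : z ∈ cutL Ω a c) : z ∈ Ω ∧ z ∉ colV Ω c :=
  (connectedComponentIn_subset _ _ hz : z ∈ Ω \ colV Ω c)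

theorem cutR_subset {z : StripA} (hz : z ∈ cutR Ω b c) : z ∈ Ω ∧ z ∉ colV Ω c :=
  (connectedComponentIn_subset _ _ hz : z ∈ Ω \ colV Ω c)

theorem sideL_subset {z : StripA} (hz : z ∈ sideL Ω a c) : z ∈ Ω ∧ z.1 < c :=
  (connectedComponentIn_subset _ _ hz : z ∈ Ω ∩ {z | z.1 < c})

theorem sideL_subset_cutL : sideL Ω a c ⊆ cutL Ω a c :=
  connectedComponentIn_mono _ fun _ hz => ⟨hz.1, fun hv => absurd hv.1 (ne_of_lt hz.2)⟩

theorem le_of_mem_closure_sideL {z : StripA} (hz : z ∈ closure (sideL Ω a c)) : z.1 ≤ c :=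
  closure_minimal (t := {z : StripA | z.1 ≤ c}) (fun _ hw => (sideL_subset hw).2.le)
    (isClosed_le continuous_fst continuous_const) hz

theorem bottom_segment {p q : ℝ} : IsPreconnected (Ioo p q ×ˢ {(0 : Set.Icc (0 : ℝ) 1)}) :=
  isPreconnected_Ioo.prod isPreconnected_singleton

theorem bottom_mem_sideL (h : TwistDisk F Ω a b) (hc : c ∈ Ioo a b) {x : ℝ} (hx : x ∈ Ioo a c) :
    ((x, 0) : StripA) ∈ sideL Ω a c := by
  refine (bottom_segment (p := a) (q := c)).subset_connectedComponentIn ?_ ?_ ⟨hx, rfl⟩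
  · exact ⟨⟨by linarith [hc.1], by linarith [hc.1]⟩, rfl⟩
  · rintro ⟨x, y⟩ ⟨hx, rfl : y = 0⟩
    exact ⟨(h.bottom x).2 ⟨hx.1, hx.2.trans hc.2⟩, hx.2⟩

theorem bottom_mem_cutR (h : TwistDisk F Ω a b) (hc : c ∈ Ioo a b) {x : ℝ} (hx : x ∈ Ioo c b) :
    ((x, 0) : StripA) ∈ cutR Ω b c := by
  refine (bottom_segment (p := c) (q := b)).subset_connectedComponentIn ?_ ?_ ⟨hx, rfl⟩
  · exact ⟨⟨by linarith [hc.2], by linarith [hc.2]⟩, rfl⟩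
  · rintro ⟨x, y⟩ ⟨hx, rfl : y = 0⟩
    exact ⟨(h.bottom x).2 ⟨hc.1.trans hx.1, hx.2⟩, fun hv => hx.1.ne' hv.1⟩

theorem exists_box (h : TwistDisk F Ω a b) {z : StripA} (hz : z ∈ colV Ω c) :
    ∃ η > 0, ∃ t, z.2 < t ∧ Ioo (c - η) (c + η) ×ˢ Iio t ⊆ Ω := by
  obtain ⟨u, v, hu, hv, hcu, hzv, huv⟩ := generalized_tube_lemma (s := {c}) (t := Iic z.2)
    isCompact_singleton isClosed_Iic.isCompact h.isOpen (by
      rintro ⟨x, y⟩ ⟨rfl : x = c, hy⟩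
      exact hz.2 y hy)
  obtain ⟨η, hη, hηu⟩ := Metric.isOpen_iff.1 hu c (hcu rfl)
  rw [Real.ball_eq_Ioo] at hηu
  have hz1 : z.2 < 1 := by
    refine lt_of_le_of_ne z.2.2.2 fun h1 => h.top c (h1 ▸ hz.2 z.2 le_rfl)
  obtain ⟨t, ht, htv⟩ := exists_Ico_subset_of_mem_nhds (hv.mem_nhds (hzv self_mem_Iic)) ⟨1, hz1⟩
  refine ⟨η, hη, t, ht, fun p hp => huv ⟨hηu hp.1, ?_⟩⟩
  rcases le_or_gt p.2 z.2 with hle | hlt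
  · exact hzv hle
  · exact htv ⟨hlt.le, hp.2⟩

theorem box_left (h : TwistDisk F Ω a b) (hc : c ∈ Ioo a b) {η : ℝ} {t : Set.Icc (0 : ℝ) 1}
    (ht : 0 < t) (hB : Ioo (c - η) (c + η) ×ˢ Iio t ⊆ Ω) {p : StripA}
    (hp : p ∈ Ioo (c - η) (c + η) ×ˢ Iio t) (hpc : p.1 < c) : p ∈ sideL Ω a c := by
  have hη : c - η < c := hp.1.1.trans hpc
  obtain ⟨x, hx1, hx2⟩ := exists_between (max_lt hη hc.1)
  have hT : IsPreconnected (Ioo (c - η) c ×ˢ Iio t) := isPreconnected_Ioo.prod isPreconnected_Iio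
  refine hT.subset_connectedComponentIn_of_mem ?_
    (p := (x, 0)) ⟨⟨(le_max_left _ _).trans_lt hx1, hx2⟩, ht⟩
    (h.bottom_mem_sideL hc ⟨(le_max_right _ _).trans_lt hx1, hx2⟩) ⟨⟨hp.1.1, hpc⟩, hp.2⟩
  intro q hq
  exact ⟨hB ⟨⟨hq.1.1, hq.1.2.trans (by linarith)⟩, hq.2⟩, hq.1.2⟩

theorem box_right (h : TwistDisk F Ω a b) (hc : c ∈ Ioo a b) {η : ℝ} {t : Set.Icc (0 : ℝ) 1}
    (ht : 0 < t) (hB : Ioo (c - η) (c + η) ×ˢ Iio t ⊆ Ω) {p : StripA}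
    (hp : p ∈ Ioo (c - η) (c + η) ×ˢ Iio t) (hpc : c < p.1) : p ∈ cutR Ω b c := by
  have hη : c < c + η := hpc.trans hp.1.2
  obtain ⟨x, hx1, hx2⟩ := exists_between (lt_min hη hc.2)
  have hT : IsPreconnected (Ioo c (c + η) ×ˢ Iio t) := isPreconnected_Ioo.prod isPreconnected_Iio
  refine hT.subset_connectedComponentIn_of_mem ?_
    (p := (x, 0)) ⟨⟨hx1, hx2.trans_le (min_le_left _ _)⟩, ht⟩
    (h.bottom_mem_cutR hc ⟨hx1, hx2.trans_le (min_le_right _ _)⟩) ⟨⟨hpc, hp.1.2⟩, hp.2⟩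
  intro q hq
  exact ⟨hB ⟨⟨by linarith [hq.1.1], hq.1.2⟩, hq.2⟩, fun hv => hq.1.1.ne' hv.1⟩

theorem box_mid {η : ℝ} {t : Set.Icc (0 : ℝ) 1}
    (hB : Ioo (c - η) (c + η) ×ˢ Iio t ⊆ Ω) {p : StripA}
    (hp : p ∈ Ioo (c - η) (c + η) ×ˢ Iio t) (hpc : p.1 = c) : p ∈ colV Ω c :=
  ⟨hpc, fun _ hy => hB ⟨hpc ▸ hp.1, hy.trans_lt hp.2⟩⟩

theorem box_mem_nhds {η : ℝ} (hη : 0 < η) {t : Set.Icc (0 : ℝ) 1} {z : StripA}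
    (hz : z.1 = c) (hzt : z.2 < t) : z ∈ Ioo (c - η) (c + η) ×ˢ Iio t :=
  ⟨hz ▸ ⟨by linarith, by linarith⟩, hzt⟩

theorem mem_cutL_or_cutR (h : TwistDisk F Ω a b) (hc : c ∈ Ioo a b) {z : StripA} (hz : z ∈ Ω)
    (hzV : z ∉ colV Ω c) : z ∈ cutL Ω a c ∨ z ∈ cutR Ω b c := by
  have := locallyConnectedSpace_stripA
  have hzG : z ∈ Ω \ colV Ω c := ⟨hz, hzV⟩
  have hzC := mem_connectedComponentIn hzG
  obtain ⟨v, hvΩ, hvC, hvn⟩ := h.conn.exists_mem_closure_diff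
    (h.isOpen_diff (c := c)).connectedComponentIn ⟨z, hz, hzC⟩ fun hsub =>
      (connectedComponentIn_subset _ _ (hsub ((h.bottom c).2 hc))).2 (h.bottom_mem_colV hc)
  have hvV : v ∈ colV Ω c := by
    by_contra hn
    exact hvn (mem_connectedComponentIn_of_closure h.isOpen_diff hvC ⟨hvΩ, hn⟩)
  obtain ⟨η, hη, t, ht, hB⟩ := h.exists_box hvV
  obtain ⟨p, hpB, hpC⟩ := mem_closure_iff.1 hvC _ (isOpen_Ioo.prod isOpen_Iio)
    (box_mem_nhds hη hvV.1 ht)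
  have ht0 : 0 < t := lt_of_le_of_lt v.2.2.1 ht
  rw [connectedComponentIn_eq hpC] at hzC
  rcases lt_trichotomy p.1 c with hlt | heq | hgt
  · left
    have := sideL_subset_cutL (h.box_left hc ht0 hB hpB hlt)
    rwa [cutL, connectedComponentIn_eq this]
  · exact absurd (box_mid hB hpB heq) (connectedComponentIn_subset _ _ hpC).2
  · right
    have := h.box_right hc ht0 hB hpB hgt
    rwa [cutR, connectedComponentIn_eq this]

theorem disjoint_cut (h : TwistDisk F Ω a b) (hc : c ∈ Ioo a b) {p : StripA}
    (hpL : p ∈ cutL Ω a c) (hpR : p ∈ cutR Ω b c) : False := by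
  have hLR : cutL Ω a c = cutR Ω b c :=
    (connectedComponentIn_eq hpL).trans (connectedComponentIn_eq hpR).symm
  have hA : Ω \ colV Ω c = cutL Ω a c := by
    refine Subset.antisymm (fun z hz => ?_) (connectedComponentIn_subset _ _)
    rcases h.mem_cutL_or_cutR hc hz.1 hz.2 with H | H
    · exact H
    · exact hLR ▸ H
  let S : Set (Set StripA) := {s | ∃ η > 0, ∃ t : Set.Icc (0 : ℝ) 1, 0 < t ∧
    s = Ioo (c - η) (c + η) ×ˢ Iio t ∧ s ⊆ Ω}
  have hSo : IsOpen (⋃₀ S) := by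
    refine isOpen_sUnion ?_
    rintro _ ⟨η, hη, t, ht, rfl, -⟩
    exact isOpen_Ioo.prod isOpen_Iio
  have hSc : IsPreconnected (⋃₀ S) := by
    refine isPreconnected_sUnion (c, 0) S ?_ ?_
    · rintro _ ⟨η, hη, t, ht, rfl, -⟩
      exact box_mem_nhds hη rfl ht
    · rintro _ ⟨η, hη, t, ht, rfl, -⟩
      exact isPreconnected_Ioo.prod isPreconnected_Iio
  have hSΩ : ⋃₀ S ⊆ Ω := by
    refine sUnion_subset ?_
    rintro _ ⟨η, hη, t, ht, -, hs⟩
    exact hs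
  have hcov : (Ω \ colV Ω c) ∪ ⋃₀ S = Ω := by
    refine Subset.antisymm (union_subset sdiff_subset hSΩ) fun z hz => ?_
    by_cases hzV : z ∈ colV Ω c
    · right
      obtain ⟨η, hη, t, ht, hB⟩ := h.exists_box hzV
      exact ⟨_, ⟨η, hη, t, lt_of_le_of_lt z.2.2.1 ht, rfl, hB⟩, box_mem_nhds hη hzV.1 ht⟩
    · exact Or.inl ⟨hz, hzV⟩
  have hcap := h.unicoh.inter_isPreconnected h.isOpen_diff hSo hcov
    (hA ▸ isPreconnected_connectedComponentIn) hSc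
  obtain ⟨η, hη, t, ht, hB⟩ := h.exists_box (h.bottom_mem_colV hc)
  have hmem : ∀ x ∈ Ioo (c - η) (c + η), x ≠ c →
      ((x, 0) : StripA) ∈ (Ω \ colV Ω c) ∩ ⋃₀ S := fun x hx hxc =>
    ⟨⟨hB ⟨hx, ht⟩, fun hv => hxc hv.1⟩, _, ⟨η, hη, t, ht, rfl, hB⟩, hx, ht⟩
  obtain ⟨w, hw, hwc⟩ := hcap.intermediate_value
    (hmem (c - η / 2) ⟨by linarith, by linarith⟩ (by linarith))
    (hmem (c + η / 2) ⟨by linarith, by linarith⟩ (by linarith)) continuous_fst.continuousOn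
    (show c ∈ Icc _ _ from ⟨by simp only; linarith, by simp only; linarith⟩)
  obtain ⟨_, ⟨η', hη', t', ht', rfl, hs⟩, hws⟩ := hw.2
  exact hw.1.2 (box_mid hs hws hwc)

theorem closure_overhang_disjoint_colV (h : TwistDisk F Ω a b) (hc : c ∈ Ioo a b) {v : StripA}
    (hv : v ∈ colV Ω c) : v ∉ closure (overhang Ω a c) := by
  intro hcl
  obtain ⟨η, hη, t, ht, hB⟩ := h.exists_box hv
  obtain ⟨p, hpB, hpD⟩ := mem_closure_iff.1 hcl _ (isOpen_Ioo.prod isOpen_Iio)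
    (box_mem_nhds hη hv.1 ht)
  have ht0 : 0 < t := lt_of_le_of_lt v.2.2.1 ht
  rcases lt_trichotomy p.1 c with hlt | heq | hgt
  · exact hpD.2 (subset_closure (h.box_left hc ht0 hB hpB hlt))
  · exact (cutL_subset hpD.1).2 (box_mid hB hpB heq)
  · exact h.disjoint_cut hc hpD.1 (h.box_right hc ht0 hB hpB hgt)

theorem bottom_notMem_overhang (h : TwistDisk F Ω a b) (hc : c ∈ Ioo a b) {x : ℝ} :
    ((x, 0) : StripA) ∉ overhang Ω a c := by
  intro hD
  have hx := (h.bottom x).1 (cutL_subset hD.1).1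
  rcases lt_trichotomy x c with hlt | rfl | hgt
  · exact hD.2 (subset_closure (h.bottom_mem_sideL hc ⟨hx.1, hlt⟩))
  · exact (cutL_subset hD.1).2 (h.bottom_mem_colV hc)
  · exact h.disjoint_cut hc hD.1 (h.bottom_mem_cutR hc ⟨hgt, hx.2⟩)

theorem frontier_overhang (h : TwistDisk F Ω a b) (hc : c ∈ Ioo a b) {z : StripA} (hz : z ∈ Ω)
    (hcl : z ∈ closure (overhang Ω a c)) (hn : z ∉ overhang Ω a c) :
    z.1 = c ∧ z ∉ colV Ω c ∧ z ∈ closure (sideL Ω a c) := by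
  have := locallyConnectedSpace_stripA
  have hV : z ∉ colV Ω c := fun hv => h.closure_overhang_disjoint_colV hc hv hcl
  have hL : z ∈ cutL Ω a c :=
    mem_connectedComponentIn_of_closure h.isOpen_diff (closure_mono sdiff_subset hcl) ⟨hz, hV⟩
  have hU : z ∈ closure (sideL Ω a c) := by
    by_contra hU
    exact hn ⟨hL, hU⟩
  refine ⟨le_antisymm (le_of_mem_closure_sideL hU) (not_lt.1 fun hlt => ?_), hV, hU⟩
  have hzU : z ∈ sideL Ω a c := mem_connectedComponentIn_of_closure h.isOpen_left hU ⟨hz, hlt⟩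
  obtain ⟨p, hpU, hpD⟩ := mem_closure_iff.1 hcl _ h.isOpen_sideL hzU
  exact hpD.2 (subset_closure hpU)

/-- Local structure of an overhang near its frontier in `Ω`. -/
theorem box_overhang (h : TwistDisk F Ω a b) (hc : c ∈ Ioo a b) {z : StripA} {p q : ℝ}
    {J : Set (Set.Icc (0 : ℝ) 1)} (hJo : IsOpen J) (hJ : J.OrdConnected)
    (hB : Ioo p q ×ˢ J ⊆ Ω) (hz : z ∈ Ioo p q ×ˢ J) (hcl : z ∈ closure (overhang Ω a c))
    (hn : z ∉ overhang Ω a c) :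
    (∀ y ∈ J, h.height c ≤ y) ∧ (∀ w ∈ Ioo p q ×ˢ J, w.1 < c → w ∈ sideL Ω a c) ∧
      ∀ w ∈ Ioo p q ×ˢ J, c < w.1 → w ∈ overhang Ω a c := by
  obtain ⟨hzc, hzV, hzU⟩ := h.frontier_overhang hc (hB hz) hcl hn
  have hJh : ∀ y ∈ J, h.height c ≤ y := by
    intro y hy
    by_contra hlt
    rw [not_le] at hlt
    have hzh : h.height c ≤ z.2 := by
      by_contra hlt'
      exact hzV (h.mem_colV.2 ⟨hzc, not_le.1 hlt'⟩)
    exact h.height_notMem c (hB ⟨hzc ▸ hz.1, hJ.out hy hz.2 ⟨hlt.le, hzh⟩⟩)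
  have hBo : IsOpen (Ioo p q ×ˢ J) := isOpen_Ioo.prod hJo
  have hleft : ∀ w ∈ Ioo p q ×ˢ J, w.1 < c → w ∈ sideL Ω a c := by
    intro w hw hwc
    obtain ⟨u, huB, huU⟩ := mem_closure_iff.1 hzU _ hBo hz
    have hT : IsPreconnected (Ioo p c ×ˢ J) := isPreconnected_Ioo.prod hJ.isPreconnected
    refine hT.subset_connectedComponentIn_of_mem (p := u) ?_
      ⟨⟨huB.1.1, (sideL_subset huU).2⟩, huB.2⟩ huU ⟨⟨hw.1.1, hwc⟩, hw.2⟩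
    exact fun v hv => ⟨hB ⟨⟨hv.1.1, hv.1.2.trans (hzc ▸ hz.1.2)⟩, hv.2⟩, hv.1.2⟩
  refine ⟨hJh, hleft, fun w hw hwc => ?_⟩
  obtain ⟨u, huB, huD⟩ := mem_closure_iff.1 hcl _ hBo hz
  have huc : c < u.1 := by
    by_contra hle
    obtain ⟨x, hxu, hxB, hxD⟩ := (((eventually_horizontal_mem hBo huB).and
      (eventually_horizontal_mem h.isOpen_overhang huD)).filter_mono
        nhdsWithin_le_nhds |>.and (self_mem_nhdsWithin (s := Iio u.1))).exists.imp
          fun x hx => (⟨hx.2, hx.1.1, hx.1.2⟩ : x < u.1 ∧ _ ∧ _)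
    exact hxD.2 (subset_closure (hleft _ hxB (hxu.trans_le (not_lt.1 hle))))
  have hT : IsPreconnected (Ioo c q ×ˢ J) := isPreconnected_Ioo.prod hJ.isPreconnected
  refine ⟨hT.subset_connectedComponentIn_of_mem (p := u) ?_
    ⟨⟨huc, huB.1.2⟩, huB.2⟩ huD.1 ⟨⟨hwc, hw.1.2⟩, hw.2⟩, ?_⟩
  · exact fun v hv => ⟨hB ⟨⟨lt_trans (hzc ▸ hz.1.1) hv.1.1, hv.1.2⟩, hv.2⟩,
      fun hV => hv.1.1.ne' hV.1⟩
  · exact fun hU => absurd (le_of_mem_closure_sideL hU) (not_le.2 hwc)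

end TwistDisk

namespace TwistDisk

variable {F : StripA ≃ₜ StripA} {Ω : Set StripA} {a b c : ℝ}

theorem apply_fst_lt (h : TwistDisk F Ω a b) {z : StripA} (hz : z ∈ colV Ω c) :
    (F z).1 < (F (c, h.height c)).1 := by
  obtain ⟨hzc, hzh⟩ := h.mem_colV.1 hz
  have := h.twist c hzh
  rw [← hzc] at this ⊢
  exact this

theorem le_apply_fst (h : TwistDisk F Ω a b) {z : StripA} (hz : z ∉ colV Ω c) (hzc : z.1 = c) :
    (F (c, h.height c)).1 ≤ (F z).1 := by
  have hle : h.height c ≤ z.2 := by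
    by_contra hlt
    exact hz (h.mem_colV.2 ⟨hzc, not_le.1 hlt⟩)
  have := (h.twist c).monotone hle
  rw [← hzc] at this ⊢
  exact this

theorem apply_height_mem (h : TwistDisk F Ω a b) (hc : c ∈ Ioo a b)
    (hD : (overhang Ω a c).Nonempty) : (F (c, h.height c)).1 ∈ Ioo a b := by
  constructor
  · have h1 := h.apply_fst_lt (h.bottom_mem_colV hc)
    have h2 := h.left_lt (h.mem_apply_iff.2 ((h.bottom c).2 hc))
    exact h2.trans h1
  · obtain ⟨w, hw⟩ := hD
    obtain ⟨z, hz, hcl, hn⟩ := h.conn.exists_mem_closure_diff (h.isOpen_overhang (c := c))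
      ⟨w, (cutL_subset hw.1).1, hw⟩ fun hsub =>
        h.bottom_notMem_overhang hc (hsub ((h.bottom c).2 hc))
    obtain ⟨hzc, hzV, -⟩ := h.frontier_overhang hc hz hcl hn
    exact (h.le_apply_fst hzV hzc).trans_lt (h.lt_right (h.mem_apply_iff.2 hz))

theorem mapsTo_cutL (h : TwistDisk F Ω a b) (hc : c ∈ Ioo a b)
    (hd : (F (c, h.height c)).1 ∈ Ioo a b) {z : StripA} (hz : z ∈ cutL Ω a c) :
    F z ∈ cutL Ω a (F (c, h.height c)).1 := by
  set d := (F (c, h.height c)).1 with hd_def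
  have hcd : (F (c, 0)).1 < d := h.apply_fst_lt (h.bottom_mem_colV hc)
  have hpre : F ⁻¹' colV Ω d ⊆ cutR Ω b c := by
    refine (F.isPreconnected_preimage.2
      h.isPreconnected_colV).subset_connectedComponentIn_of_mem (p := ((F.symm (d, 0)).1, 0)) ?_ ?_
        (h.bottom_mem_cutR hc ⟨?_, ?_⟩)
    · intro w hw
      refine ⟨h.mem_apply_iff.1 (colV_subset _ hw), fun hv => ?_⟩
      have := h.apply_fst_lt hv
      rw [hw.1] at this
      exact lt_irrefl _ this
    · rw [mem_preimage, h.apply_symm_bot]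
      exact h.bottom_mem_colV hd
    · rw [← h.mono.lt_iff_lt]
      simpa only [h.apply_symm_bot] using hcd
    · refine h.lt_right (h.mem_symm_iff.2 ((h.bottom d).2 hd))
  have hsub : F '' cutL Ω a c ⊆ cutL Ω a d := by
    have hmid : (a + c) / 2 ∈ Ioo a c := ⟨by linarith [hc.1], by linarith [hc.1]⟩
    refine (isPreconnected_connectedComponentIn.image F
      F.continuous.continuousOn).subset_connectedComponentIn_of_mem ?_
        (p := F ((a + c) / 2, 0)) (mem_image_of_mem _ (sideL_subset_cutL
          (h.bottom_mem_sideL hc hmid))) ?_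
    · rintro _ ⟨w, hw, rfl⟩
      exact ⟨h.mem_apply_iff.2 (cutL_subset hw).1, fun hv => h.disjoint_cut hc hw (hpre hv)⟩
    · rw [h.apply_bot]
      refine sideL_subset_cutL (h.bottom_mem_sideL hd ⟨?_, (h.mono hmid.2).trans hcd⟩)
      exact h.left_lt (h.mem_apply_iff.2 ((h.bottom _).2 ⟨hmid.1, hmid.2.trans hc.2⟩))
  exact hsub (mem_image_of_mem _ hz)

theorem mapsTo_overhang (h : TwistDisk F Ω a b) (hc : c ∈ Ioo a b) {z : StripA}
    (hz : z ∈ overhang Ω a c) : F z ∈ overhang Ω a (F (c, h.height c)).1 := by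
  have hd := h.apply_height_mem hc ⟨z, hz⟩
  refine ⟨h.mapsTo_cutL hc hd hz.1, fun hcl => ?_⟩
  set d := (F (c, h.height c)).1 with hd_def
  obtain ⟨u, huD, huU⟩ := mem_closure_iff.1 hcl (F.symm ⁻¹' overhang Ω a c)
    (h.isOpen_overhang.preimage F.symm.continuous) (by simpa using hz)
  have hmid : (a + d) / 2 ∈ Ioo a d := ⟨by linarith [hd.1], by linarith [hd.1]⟩
  obtain ⟨w, hw, hwcl, hwn⟩ := (F.isPreconnected_preimage.2
    (isPreconnected_connectedComponentIn (F := Ω ∩ {z | z.1 < d})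
      (x := ((a + d) / 2, 0)))).exists_mem_closure_diff (h.isOpen_overhang (c := c))
    ⟨F.symm u, by rw [mem_preimage, F.apply_symm_apply]; exact huU, huD⟩ fun hsub => by
      have hm : ((F.symm ((a + d) / 2, 0)).1, 0) ∈ F ⁻¹' sideL Ω a d := by
        rw [mem_preimage, h.apply_symm_bot]
        exact h.bottom_mem_sideL hd hmid
      exact h.bottom_notMem_overhang hc (hsub hm)
  have hw' := sideL_subset hw
  obtain ⟨hwc, hwV, -⟩ := h.frontier_overhang hc (h.mem_apply_iff.1 hw'.1) hwcl hwn
  exact absurd hw'.2 (not_lt.2 (h.le_apply_fst hwV hwc))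

theorem exists_frontier_overhang (h : TwistDisk F Ω a b) {e : ℝ} (he : e ∈ Ioo a b) {p q : ℝ}
    {J J' : Set (Set.Icc (0 : ℝ) 1)} (hJo : IsOpen J) (hJ : J.OrdConnected) (hJJ : J' ⊆ J)
    (hJ' : J'.OrdConnected) (hB : Ioo p q ×ˢ J ⊆ Ω) {x w : StripA} (hx : x ∈ Ioo p q ×ˢ J')
    (hxD : x ∉ overhang Ω a e) (hw : w ∈ Ioo p q ×ˢ J') (hwD : w ∈ overhang Ω a e) :
    e ∈ Ioo p q ∧ x.1 ≤ e ∧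
    (∀ y ∈ J, h.height e ≤ y) ∧ (∀ w ∈ Ioo p q ×ˢ J, w.1 < e → w ∈ sideL Ω a e) := by
  obtain ⟨z, hz, hcl, hn⟩ := (isPreconnected_Ioo.prod hJ'.isPreconnected).exists_mem_closure_diff
    (h.isOpen_overhang (c := e)) ⟨w, hw, hwD⟩ fun hsub => hxD (hsub hx)
  have hzB : z ∈ Ioo p q ×ˢ J := ⟨hz.1, hJJ hz.2⟩
  obtain ⟨hze, -, -⟩ := h.frontier_overhang he (hB hzB) hcl hn
  obtain ⟨h1, h2, h3⟩ := h.box_overhang he hJo hJ hB hzB hcl hn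
  exact ⟨hze ▸ hz.1, not_lt.1 fun hlt => hxD (h3 x ⟨hx.1, hJJ hx.2⟩ hlt), h1, h2⟩

theorem exists_interval {N : Set StripA} (hN : IsOpen N) {q : StripA} (hq : q ∈ N) :
    ∃ η > 0, ∃ J : Set (Set.Icc (0 : ℝ) 1), IsOpen J ∧ J.OrdConnected ∧ q.2 ∈ J ∧
      Ioo (q.1 - η) (q.1 + η) ×ˢ J ⊆ N := by
  obtain ⟨u, v, hu, hv, hqu, hqv, huv⟩ := isOpen_prod_iff.1 hN q.1 q.2 hq
  obtain ⟨η, hη, hηu⟩ := Metric.isOpen_iff.1 hu _ hqu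
  rw [Real.ball_eq_Ioo] at hηu
  have := locallyConnectedSpace_Icc
  exact ⟨η, hη, connectedComponentIn v q.2, hv.connectedComponentIn,
    isPreconnected_connectedComponentIn.ordConnected, mem_connectedComponentIn hqv,
    (Set.prod_mono hηu (connectedComponentIn_subset _ _)).trans huv⟩

/-- A recurrent twist disk has no overhang. -/
theorem overhang_eq_empty (h : TwistDisk F Ω a b) (hc : c ∈ Ioo a b) : overhang Ω a c = ∅ := by
  by_contra hne
  obtain ⟨w₀, hw₀⟩ := nonempty_iff_ne_empty.2 hne
  let E : Set StripA := ⋃ e ∈ Ioo a b, overhang Ω a e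
  have hE : ∀ {z}, z ∈ E ↔ ∃ e ∈ Ioo a b, z ∈ overhang Ω a e := by simp [E]
  have hEo : IsOpen E := isOpen_biUnion fun e _ => h.isOpen_overhang
  have hEF : MapsTo F E E := by
    intro z hz
    obtain ⟨e, he, hze⟩ := hE.1 hz
    exact hE.2 ⟨_, h.apply_height_mem he ⟨z, hze⟩, h.mapsTo_overhang he hze⟩
  obtain ⟨q, hq, hqcl, hqE⟩ := h.conn.exists_mem_closure_diff hEo
    ⟨w₀, (cutL_subset hw₀.1).1, hE.2 ⟨c, hc, hw₀⟩⟩ fun hsub => by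
      obtain ⟨e, he, hce⟩ := hE.1 (hsub ((h.bottom c).2 hc))
      exact h.bottom_notMem_overhang he hce
  have hqD : ∀ e ∈ Ioo a b, q ∉ overhang Ω a e := fun e he hqe => hqE (hE.2 ⟨e, he, hqe⟩)
  obtain ⟨η₀, hη₀, J, hJo, hJ, hqJ, hB₀⟩ := exists_interval h.isOpen hq
  have hq2 : 0 < q.2 := by
    refine lt_of_le_of_ne q.2.2.1 fun h0 => ?_
    have hqB : q ∈ Ioo (q.1 - η₀) (q.1 + η₀) ×ˢ J := ⟨⟨by linarith, by linarith⟩, hqJ⟩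
    obtain ⟨w, hwB, hwE⟩ := mem_closure_iff.1 hqcl _ (isOpen_Ioo.prod hJo) hqB
    obtain ⟨e, he, hwe⟩ := hE.1 hwE
    have := (h.exists_frontier_overhang he hJo hJ Subset.rfl hJ hB₀ hqB (hqD e he) hwB hwe).2.2.1
      q.2 hqJ
    exact absurd (h.height_pos he) (not_lt.2 (h0 ▸ this))
  obtain ⟨l, hl, hlJ⟩ := exists_Ioc_subset_of_mem_nhds (hJo.mem_nhds hqJ) ⟨0, hq2⟩
  obtain ⟨y, hly, hyq⟩ := exists_between hl
  have hyJ : y ∈ J := hlJ ⟨hly, hyq.le⟩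
  have hφ : Continuous fun z => (F z).1 := continuous_fst.comp F.continuous
  obtain ⟨m, hm1, hm2⟩ := exists_between (show (F (q.1, y)).1 < (F q).1 from h.twist q.1 hyq)
  obtain ⟨η₁, hη₁, hball⟩ := Metric.isOpen_iff.1
    (isOpen_lt (hφ.comp (Continuous.prodMk_left y)) (continuous_const (y := m))) q.1 hm1
  rw [Real.ball_eq_Ioo] at hball
  have hNo : IsOpen (univ ×ˢ J ∩ {z : StripA | m < (F z).1}) :=
    (isOpen_univ.prod hJo).inter (isOpen_lt continuous_const hφ)
  obtain ⟨η₂, hη₂, J', hJo', hJ', hqJ', hB'⟩ := exists_interval hNo ⟨⟨mem_univ _, hqJ⟩, hm2⟩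
  have hJJ : J' ⊆ J := fun t ht =>
    (hB' (show (q.1, t) ∈ _ from ⟨⟨by simp only; linarith, by simp only; linarith⟩, ht⟩)).1.2
  set η := min η₀ (min η₁ η₂) with hη_def
  have hη : 0 < η := lt_min hη₀ (lt_min hη₁ hη₂)
  have hle₀ : η ≤ η₀ := min_le_left _ _
  have hle₁ : η ≤ η₁ := (min_le_right _ _).trans (min_le_left _ _)
  have hle₂ : η ≤ η₂ := (min_le_right _ _).trans (min_le_right _ _)
  have hI : ∀ {ε}, η ≤ ε → Ioo (q.1 - η) (q.1 + η) ⊆ Ioo (q.1 - ε) (q.1 + ε) := fun hε =>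
    Ioo_subset_Ioo (by linarith) (by linarith)
  set I := Ioo (q.1 - η) (q.1 + η) with hI_def
  have hB : I ×ˢ J ⊆ Ω := (Set.prod_mono (hI hle₀) Subset.rfl).trans hB₀
  have hqB : q ∈ I ×ˢ J' := ⟨⟨by linarith, by linarith⟩, hqJ'⟩
  have hkey : ∀ {e w}, e ∈ Ioo a b → w ∈ I ×ˢ J' → w ∈ overhang Ω a e → e ∈ I ∧ q.1 ≤ e ∧
      (∀ y ∈ J, h.height e ≤ y) ∧ (∀ w ∈ I ×ˢ J, w.1 < e → w ∈ sideL Ω a e) :=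
    fun he hw hwe => h.exists_frontier_overhang he hJo hJ hJJ hJ' hB hqB (hqD _ he) hw hwe
  have hleft : ∀ w ∈ I ×ˢ J', w.1 < q.1 → w ∉ E := by
    intro w hw hwq hwE
    obtain ⟨e, he, hwe⟩ := hE.1 hwE
    obtain ⟨-, hqe, -, hU⟩ := hkey he hw hwe
    exact hwe.2 (subset_closure (hU w ⟨hw.1, hJJ hw.2⟩ (hwq.trans_le hqe)))
  obtain ⟨p, hpB, hpE⟩ := mem_closure_iff.1 hqcl _ (isOpen_Ioo.prod hJo') hqB
  obtain ⟨e, he, hpe⟩ := hE.1 hpE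
  obtain ⟨heI, -, heh, -⟩ := hkey he hpB hpe
  have hdm : (F (e, h.height e)).1 < m :=
    ((h.twist e).monotone (heh y hyJ)).trans_lt (hball (hI hle₁ heI))
  have hd := h.apply_height_mem he ⟨p, hpe⟩
  have himg : F '' (I ×ˢ J') ⊆ E := by
    intro v hv
    refine hE.2 ⟨_, hd, ?_⟩
    by_contra hvn
    obtain ⟨_, ⟨w, hw, rfl⟩, hcl, hn⟩ := ((isPreconnected_Ioo.prod hJ'.isPreconnected).image F
      F.continuous.continuousOn).exists_mem_closure_diff (h.isOpen_overhang (c := _))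
      ⟨_, mem_image_of_mem F hpB, h.mapsTo_overhang he hpe⟩ fun hsub => hvn (hsub hv)
    have hwd := (h.frontier_overhang hd (h.mem_apply_iff.2 (hB ⟨hw.1, hJJ hw.2⟩)) hcl hn).1
    have hmw : m < (F w).1 := (hB' ⟨hI hle₂ hw.1, hw.2⟩).2
    linarith
  have hN := h.not_wandering (N := F.symm ⁻¹' (I ×ˢ J' ∩ {z | z.1 < q.1})) hEF
    (((isOpen_Ioo.prod hJo').inter (isOpen_lt continuous_fst continuous_const)).preimage
      F.symm.continuous)
    (fun v hv => himg ⟨F.symm v, hv.1, F.apply_symm_apply v⟩)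
    (fun v hv => h.mem_symm_iff.1 (hB ⟨hv.1.1, hJJ hv.1.2⟩)) fun z hz hzN => by
      simp only [mem_preimage, F.symm_apply_apply] at hzN
      exact hleft z hzN.1 hzN.2 hz
  have : F (q.1 - η / 2, q.2) ∈ F.symm ⁻¹' (I ×ˢ J' ∩ {z | z.1 < q.1}) := by
    rw [mem_preimage, F.symm_apply_apply]
    exact ⟨⟨⟨by simp only; linarith, by simp only; linarith⟩, hqJ'⟩,
      show q.1 - η / 2 < q.1 by linarith⟩
  rw [hN] at this
  exact this

theorem lt_of_mem_cutL (h : TwistDisk F Ω a b) (hc : c ∈ Ioo a b) {z : StripA}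
    (hz : z ∈ cutL Ω a c) : z.1 < c := by
  have hle : ∀ w ∈ cutL Ω a c, w.1 ≤ c := by
    intro w hw
    by_contra hlt
    have : w ∈ overhang Ω a c := ⟨hw, fun hcl => hlt (le_of_mem_closure_sideL hcl)⟩
    rw [h.overhang_eq_empty hc] at this
    exact this
  refine lt_of_le_of_ne (hle z hz) fun heq => ?_
  obtain ⟨x, hx, hxz⟩ := (((eventually_horizontal_mem h.isOpen_cutL hz).filter_mono
    nhdsWithin_le_nhds).and (self_mem_nhdsWithin (s := Ioi z.1))).exists
  exact absurd (hle _ hx) (not_le.2 (heq ▸ hxz))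

theorem lt_of_mem_cutR (h : TwistDisk F Ω a b) (hc : c ∈ Ioo a b) {z : StripA}
    (hz : z ∈ cutR Ω b c) : c < z.1 := by
  have hc' : -c ∈ Ioo (-b) (-a) := ⟨neg_lt_neg hc.2, neg_lt_neg hc.1⟩
  have hsub : reflect ⁻¹' cutR Ω b c ⊆ cutL (reflect ⁻¹' Ω) (-b) (-c) := by
    refine (reflect.isPreconnected_preimage.2
      isPreconnected_connectedComponentIn).subset_connectedComponentIn ?_ ?_
    · have := h.bottom_mem_cutR hc (x := (c + b) / 2) ⟨by linarith [hc.2], by linarith [hc.2]⟩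
      have he : -((-b + -c) / 2) = (c + b) / 2 := by ring
      rw [mem_preimage, reflect_apply, he]
      exact this
    · intro w hw
      obtain ⟨h1, h2⟩ := cutR_subset hw
      refine ⟨h1, fun hv => h2 ⟨?_, fun y hy => ?_⟩⟩
      · simp [hv.1]
      · simpa using hv.2 y hy
  have := h.reflected.lt_of_mem_cutL hc' (z := reflect z) (hsub (by simpa using hz))
  simpa using this

/-- A recurrent twist disk is vertically star-shaped from below. -/
theorem mem_of_le (h : TwistDisk F Ω a b) {x : ℝ} {y y' : Set.Icc (0 : ℝ) 1}
    (hz : ((x, y) : StripA) ∈ Ω) (hy : y' ≤ y) : ((x, y') : StripA) ∈ Ω := by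
  have hx : x ∈ Ioo a b := ⟨h.left_lt hz, h.lt_right hz⟩
  by_cases hV : ((x, y) : StripA) ∈ colV Ω x
  · exact hV.2 y' hy
  · rcases h.mem_cutL_or_cutR hx hz hV with H | H
    · exact absurd (h.lt_of_mem_cutL hx H) (lt_irrefl _)
    · exact absurd (h.lt_of_mem_cutR hx H) (lt_irrefl _)

end TwistDisk

theorem continuous_of_isClosed_graph {X Y : Type*} [TopologicalSpace X] [TopologicalSpace Y]
    [CompactSpace Y] {f : X → Y} (hf : IsClosed {p : X × Y | f p.1 = p.2}) : Continuous f := by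
  refine continuous_iff_isClosed.2 fun C hC => ?_
  have : f ⁻¹' C = Prod.fst '' ({p : X × Y | f p.1 = p.2} ∩ Prod.snd ⁻¹' C) := by
    ext x
    constructor
    · exact fun hx => ⟨(x, f x), ⟨rfl, hx⟩, rfl⟩
    · rintro ⟨⟨x, y⟩, ⟨hxy : f x = y, hy⟩, rfl⟩
      rw [← hxy] at hy
      exact hy
  rw [this]
  exact isClosedMap_fst_of_compactSpace _ (hf.inter (hC.preimage continuous_snd))

namespace TwistDisk

variable {F : StripA ≃ₜ StripA} {Ω : Set StripA} {a b : ℝ}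

theorem section_right (h : TwistDisk F Ω a b) {x : ℝ} {y₁ y₂ : Set.Icc (0 : ℝ) 1} (hy : y₁ < y₂)
    (h₁ : ((x, y₁) : StripA) ∉ Ω) : ((x, y₂) : StripA) ∉ closure (Ω ∩ {z | x < z.1}) := by
  intro hcl
  obtain ⟨y₀, hy₁, hy₂⟩ := exists_between hy
  have hψ : Continuous fun z => (F.symm z).1 := continuous_fst.comp F.symm.continuous
  have hψ₁ : Continuous fun z : StripA => (F.symm (z.1, y₁)).1 :=
    hψ.comp (continuous_fst.prodMk continuous_const)
  set d := (F.symm (x, y₀)).1 with hd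
  have hw : ((d, (F.symm (x, y₀)).2) : StripA) ∉ Ω := by
    rw [hd, Prod.mk.eta, h.mem_symm_iff]
    exact fun hn => h₁ (h.mem_of_le hn hy₁.le)
  obtain ⟨p, ⟨⟨hp₁, hp₂⟩, hp₃⟩, hpΩ, hpx⟩ := mem_closure_iff.1 hcl
    ({z | (F.symm z).1 < d} ∩ {z | d < (F.symm (z.1, y₁)).1} ∩ {z | y₁ < z.2})
    (((isOpen_lt hψ continuous_const).inter (isOpen_lt continuous_const hψ₁)).inter
      (isOpen_lt continuous_const continuous_snd))
    ⟨⟨h.twist_symm x hy₂, h.twist_symm x hy₁⟩, hy⟩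
  obtain ⟨y, hyI, hyd⟩ := (ordConnected_Icc (a := y₁) (b := p.2)).isPreconnected.intermediate_value
    (right_mem_Icc.2 (le_of_lt hp₃)) (left_mem_Icc.2 (le_of_lt hp₃))
    (hψ.comp (Continuous.prodMk_right p.1)).continuousOn
    (show d ∈ Icc _ _ from ⟨le_of_lt hp₁, le_of_lt hp₂⟩)
  have hΩ : F.symm (p.1, y) ∈ Ω := h.mem_symm_iff.2 (h.mem_of_le (y := p.2) hpΩ hyI.2)
  have heq : F.symm (p.1, y) = (d, (F.symm (p.1, y)).2) := Prod.ext hyd rfl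
  have hlt : (F.symm (p.1, y)).2 < (F.symm (x, y₀)).2 := by
    by_contra hle
    rw [heq] at hΩ
    exact hw (h.mem_of_le hΩ (not_lt.1 hle))
  have : (F (d, (F.symm (p.1, y)).2)).1 < (F (d, (F.symm (x, y₀)).2)).1 := h.twist d hlt
  rw [← heq, hd] at this
  simp only [Prod.mk.eta, F.apply_symm_apply] at this
  exact absurd (show x < p.1 from hpx) (not_lt.2 this.le)

theorem section_left (h : TwistDisk F Ω a b) {x : ℝ} {y₁ y₂ : Set.Icc (0 : ℝ) 1} (hy : y₁ < y₂)
    (h₁ : ((x, y₁) : StripA) ∉ Ω) : ((x, y₂) : StripA) ∉ closure (Ω ∩ {z | z.1 < x}) := by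
  have := h.reflected.section_right (x := -x) hy (by simpa using h₁)
  have he : reflect ⁻¹' Ω ∩ {z | -x < z.1} = reflect ⁻¹' (Ω ∩ {z | z.1 < x}) := by
    ext z
    refine and_congr_right fun _ => ?_
    change -x < z.1 ↔ -z.1 < x
    constructor <;> intro <;> linarith
  rw [he, ← reflect.preimage_closure] at this
  simpa using this

/-- The relative frontier of `Ω` meets each vertical at most once. -/
theorem section_subsingleton (h : TwistDisk F Ω a b) {x : ℝ} {y₁ y₂ : Set.Icc (0 : ℝ) 1}
    (h₁ : ((x, y₁) : StripA) ∈ closure Ω \ Ω) (h₂ : ((x, y₂) : StripA) ∈ closure Ω \ Ω) :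
    y₁ = y₂ := by
  by_contra hne
  wlog hlt : y₁ < y₂ generalizing y₁ y₂
  · exact this h₂ h₁ (Ne.symm hne) (lt_of_le_of_ne (not_lt.1 hlt) (Ne.symm hne))
  have hsub : Ω ∩ {z | y₁ < z.2} ⊆ (Ω ∩ {z | x < z.1}) ∪ (Ω ∩ {z | z.1 < x}) := by
    rintro ⟨x', y'⟩ ⟨hz, hy : y₁ < y'⟩
    rcases lt_trichotomy x x' with H | rfl | H
    · exact Or.inl ⟨hz, H⟩
    · exact absurd (h.mem_of_le hz hy.le) h₁.2
    · exact Or.inr ⟨hz, H⟩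
  have hmem : ((x, y₂) : StripA) ∈ closure (Ω ∩ {z | y₁ < z.2}) := by
    have ho : IsOpen {z : StripA | y₁ < z.2} := isOpen_lt continuous_const continuous_snd
    rw [inter_comm]
    exact ho.inter_closure ⟨hlt, h₂.1⟩
  have := closure_mono hsub hmem
  rw [closure_union] at this
  exact this.elim (h.section_right hlt h₁.2) (h.section_left hlt h₁.2)

theorem mem_Icc_of_closure (h : TwistDisk F Ω a b) {z : StripA} (hz : z ∈ closure Ω) :
    z.1 ∈ Icc a b :=
  closure_minimal (t := Prod.fst ⁻¹' Icc a b) (fun _ hw => ⟨(h.left_lt hw).le, (h.lt_right hw).le⟩)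
    (isClosed_Icc.preimage continuous_fst) hz

theorem left_mem_closure (h : TwistDisk F Ω a b) : ((a, 0) : StripA) ∈ closure Ω := by
  have ht : Tendsto (fun x : ℝ => ((x, 0) : StripA)) (𝓝[>] a) (𝓝 (a, 0)) :=
    ((Continuous.prodMk_left 0).tendsto a).mono_left nhdsWithin_le_nhds
  refine mem_closure_of_tendsto ht ?_
  filter_upwards [Ioo_mem_nhdsGT h.lt] with x hx using (h.bottom x).2 hx

theorem right_mem_closure (h : TwistDisk F Ω a b) : ((b, 0) : StripA) ∈ closure Ω := by
  have ht : Tendsto (fun x : ℝ => ((x, 0) : StripA)) (𝓝[<] b) (𝓝 (b, 0)) :=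
    ((Continuous.prodMk_left 0).tendsto b).mono_left nhdsWithin_le_nhds
  refine mem_closure_of_tendsto ht ?_
  filter_upwards [Ioo_mem_nhdsLT h.lt] with x hx using (h.bottom x).2 hx

theorem height_mem_closure (h : TwistDisk F Ω a b) {c : ℝ} (hc : c ∈ Ioo a b) :
    ((c, h.height c) : StripA) ∈ closure Ω := by
  have h1 : h.height c ∈ closure (Iio (h.height c)) := by
    rw [closure_Iio' (⟨0, h.height_pos hc⟩ : (Iio (h.height c)).Nonempty)]
    exact self_mem_Iic
  exact map_mem_closure (Continuous.prodMk_right c) h1 fun y hy => h.mem_of_lt_height hy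

theorem bottom_mem_closure_diff (h : TwistDisk F Ω a b) {x : ℝ} :
    ((x, 0) : StripA) ∈ closure Ω \ Ω ↔ x = a ∨ x = b := by
  constructor
  · intro hx
    have hI := h.mem_Icc_of_closure hx.1
    by_contra! hn
    exact hx.2 ((h.bottom x).2 ⟨lt_of_le_of_ne hI.1 (Ne.symm hn.1), lt_of_le_of_ne hI.2 hn.2⟩)
  · rintro (rfl | rfl)
    · exact ⟨h.left_mem_closure, fun hm => lt_irrefl _ ((h.bottom _).1 hm).1⟩
    · exact ⟨h.right_mem_closure, fun hm => lt_irrefl _ ((h.bottom _).1 hm).2⟩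

/-- The relative frontier of a twist disk is the graph of a continuous function on `[a, b]`
vanishing exactly at the endpoints. -/
theorem exists_graph (h : TwistDisk F Ω a b) : ∃ φ : ℝ → Set.Icc (0 : ℝ) 1, Continuous φ ∧
    (∀ z : StripA, z ∈ closure Ω \ Ω ↔ z.1 ∈ Icc a b ∧ φ z.1 = z.2) ∧
    ∀ x ∈ Icc a b, φ x = 0 ↔ x = a ∨ x = b := by
  have hex : ∀ x : Icc a b, ∃ y, ((x, y) : StripA) ∈ closure Ω \ Ω := by
    rintro ⟨x, hx⟩
    by_cases hn : x = a ∨ x = b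
    · exact ⟨0, h.bottom_mem_closure_diff.2 hn⟩
    · push Not at hn
      exact ⟨h.height x, h.height_mem_closure
        ⟨lt_of_le_of_ne hx.1 (Ne.symm hn.1), lt_of_le_of_ne hx.2 hn.2⟩, h.height_notMem x⟩
  choose φ hφ using hex
  have hiff : ∀ (x : Icc a b) (y), φ x = y ↔ ((x, y) : StripA) ∈ closure Ω \ Ω := fun x y =>
    ⟨fun he => he ▸ hφ x, fun hy => h.section_subsingleton (hφ x) hy⟩
  have hcont : Continuous φ := by
    apply continuous_of_isClosed_graph
    simp only [hiff]
    exact (isClosed_closure.sdiff h.isOpen).preimage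
      ((continuous_subtype_val.comp continuous_fst).prodMk continuous_snd)
  refine ⟨IccExtend h.lt.le φ, hcont.Icc_extend', fun z => ⟨fun hz => ?_, fun hz => ?_⟩,
    fun x hx => ?_⟩
  · have hI := h.mem_Icc_of_closure hz.1
    exact ⟨hI, by rw [IccExtend_of_mem _ _ hI, hiff]; exact hz⟩
  · rw [IccExtend_of_mem _ _ hz.1, hiff] at hz
    exact hz.2
  · rw [IccExtend_of_mem _ _ hx, hiff]
    exact h.bottom_mem_closure_diff

end TwistDisk

theorem AddCircle.eq_of_coe_eq_of_abs_lt {x y : ℝ} (h : (x : 𝕋) = y) (hxy : |x - y| < 1) :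
    x = y := by
  have h0 : ((x - y : ℝ) : 𝕋) = 0 := by rw [AddCircle.coe_sub, h, sub_self]
  obtain ⟨n, hn⟩ := (AddCircle.coe_eq_zero_iff (1 : ℝ)).1 h0
  rw [zsmul_eq_mul, mul_one] at hn
  rw [← hn, ← Int.cast_abs] at hxy
  have : |n| < 1 := by exact_mod_cast hxy
  rw [Int.abs_lt_one_iff.1 this, Int.cast_zero] at hn
  linarith

/-- There is no continuous section of the covering `ℝ → 𝕋`. -/
theorem circle_no_section : ¬ ∃ G : C(𝕋, ℝ), ∀ x, (G x : 𝕋) = x := by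
  rintro ⟨G, hG⟩
  have hc : Continuous ((↑) : ℝ → 𝕋) := AddCircle.continuous_mk' 1
  have := isPreconnected_univ.eq_of_circle_eq_zero (G := fun t : ℝ => G (t : 𝕋) - t)
    ((G.continuous.comp hc).sub continuous_id).continuousOn
    (fun t _ => by rw [AddCircle.coe_sub, hG, sub_self]) (mem_univ 0) (mem_univ 1)
  have h1 : ((1 : ℝ) : 𝕋) = 0 := AddCircle.coe_period 1
  simp [h1] at this
  linarith

theorem circle_id_not_nullhomotopic : ¬ (ContinuousMap.id 𝕋).Nullhomotopic := by
  intro h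
  have := (contractible_iff_id_nullhomotopic 𝕋).2 h
  have : LocallyPathConnectedSpace 𝕋 :=
    (isQuotientMap_quot_mk (r := ((QuotientAddGroup.leftRel
      (AddSubgroup.zmultiples (1 : ℝ))).r))).locallyPathConnectedSpace
  obtain ⟨G, hG⟩ := hasCircleLifts_of_simplyConnected 𝕋 (ContinuousMap.id 𝕋)
  exact circle_no_section ⟨G, hG⟩

theorem IsOpen.eq_connectedComponentIn_compl_frontier {X : Type*} [TopologicalSpace X] {U : Set X}
    (hU : IsOpen U) (hc : IsPreconnected U) {z : X} (hz : z ∈ U) :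
    U = connectedComponentIn (frontier U)ᶜ z := by
  have hsub : U ⊆ (frontier U)ᶜ :=
    subset_compl_iff_disjoint_left.2 (disjoint_frontier_iff_isOpen.2 hU)
  refine Subset.antisymm (hc.subset_connectedComponentIn hz hsub) ?_
  refine isPreconnected_connectedComponentIn.subset_of_closure_inter_subset hU
    ⟨z, mem_connectedComponentIn (hsub hz), hz⟩ fun w hw => ?_
  by_contra hn
  refine connectedComponentIn_subset _ _ hw.2 ⟨hw.1, ?_⟩
  rwa [hU.interior_eq]

theorem continuous_annProj : Continuous annProj :=
  ((AddCircle.continuous_mk' (1 : ℝ)).comp continuous_fst).prodMk continuous_snd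

theorem mem_C0 {z : Ann} : z ∈ C0 ↔ z.2 = 0 :=
  ⟨fun h => Subtype.ext h, fun h => by rw [C0, mem_ofPred, h]; rfl⟩

namespace TwistDisk

variable {F : StripA ≃ₜ StripA} {Ω : Set StripA} {a b : ℝ}

theorem length_le_one (h : TwistDisk F Ω a b) (hinj : InjOn annProj Ω) : b ≤ a + 1 := by
  by_contra! hlt
  obtain ⟨x, hx₁, hx₂⟩ := exists_between (show a < b - 1 by linarith)
  have hx : ((x, 0) : StripA) ∈ Ω := (h.bottom x).2 ⟨hx₁, by linarith⟩
  have hx' : ((x + 1, 0) : StripA) ∈ Ω := (h.bottom _).2 ⟨by linarith, by linarith⟩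
  have := hinj hx hx' (by simp [annProj])
  have := (Prod.mk.inj this).1
  linarith

theorem frontier_image (h : TwistDisk F Ω a b) (hinj : InjOn annProj Ω)
    (hUo : IsOpen (annProj '' Ω)) : frontier (annProj '' Ω) = annProj '' (closure Ω \ Ω) := by
  have hb := h.length_le_one hinj
  have hcpt : IsCompact (closure Ω) :=
    (isCompact_Icc.prod isCompact_univ).of_isClosed_subset isClosed_closure
      fun z hz => ⟨h.mem_Icc_of_closure hz, mem_univ _⟩
  have hcl : closure (annProj '' Ω) = annProj '' closure Ω :=
    Subset.antisymm (closure_minimal (image_mono subset_closure)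
      (hcpt.image continuous_annProj).isClosed) (image_closure_subset_closure_image
        continuous_annProj)
  rw [hUo.frontier_eq, hcl]
  ext u
  constructor
  · rintro ⟨⟨w, hw, rfl⟩, hn⟩
    exact ⟨w, ⟨hw, fun hwΩ => hn ⟨w, hwΩ, rfl⟩⟩, rfl⟩
  · rintro ⟨w, hw, rfl⟩
    refine ⟨⟨w, hw.1, rfl⟩, ?_⟩
    rintro ⟨v, hv, hvw⟩
    have hvw' := Prod.mk.inj hvw
    have hwI := h.mem_Icc_of_closure hw.1
    have hv₁ := h.left_lt hv
    have hv₂ := h.lt_right hv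
    have h1 : v.1 = w.1 := AddCircle.eq_of_coe_eq_of_abs_lt hvw'.1 (by
      rw [abs_lt]
      constructor <;> linarith [hwI.1, hwI.2])
    exact hw.2 ((Prod.ext h1 hvw'.2 : v = w) ▸ hv)

theorem conclusion (h : TwistDisk F Ω a b) (hinj : InjOn annProj Ω)
    (hUo : IsOpen (annProj '' Ω)) :
    IsRegularLowerDisk (annProj '' Ω) ∧
      ∀ x : 𝕋, Set.Subsingleton {z : Ann | z ∈ frontier (annProj '' Ω) ∧ z.1 = x} := by
  have hb := h.length_le_one hinj
  have hab := h.lt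
  obtain ⟨φ, hφ, hK, hφ0⟩ := h.exists_graph
  have hUc : IsPreconnected (annProj '' Ω) := h.conn.image _ continuous_annProj.continuousOn
  have hm : annProj ((a + b) / 2, 0) ∈ annProj '' Ω :=
    mem_image_of_mem _ ((h.bottom _).2 ⟨by linarith, by linarith⟩)
  have hcomp := hUo.eq_connectedComponentIn_compl_frontier hUc hm
  have hfr : frontier (annProj '' Ω) = (fun x => annProj (x, φ x)) '' Icc a b := by
    rw [h.frontier_image hinj hUo]
    ext u
    constructor
    · rintro ⟨w, hw, rfl⟩
      obtain ⟨h1, h2⟩ := (hK w).1 hw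
      exact ⟨w.1, h1, by simp only [h2, Prod.mk.eta]⟩
    · rintro ⟨x, hx, rfl⟩
      exact ⟨(x, φ x), (hK _).2 ⟨hx, rfl⟩, rfl⟩
  have hφa : φ a = 0 := (hφ0 a (left_mem_Icc.2 hab.le)).2 (Or.inl rfl)
  have hφb : φ b = 0 := (hφ0 b (right_mem_Icc.2 hab.le)).2 (Or.inr rfl)
  have hcont : Continuous fun x => annProj (x, φ x) :=
    continuous_annProj.comp (continuous_id.prodMk hφ)
  refine ⟨?_, ?_⟩
  · rcases hb.lt_or_eq with hlt | rfl
    · left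
      have hIcc : ∀ t : Icc (0 : ℝ) 1, a + t * (b - a) ∈ Icc a b := fun t =>
        ⟨by nlinarith [t.2.1], by nlinarith [t.2.2]⟩
      refine ⟨⟨fun t => annProj (a + t * (b - a), φ (a + t * (b - a))), hcont.comp (by fun_prop)⟩,
        ?_, ?_, annProj ((a + b) / 2, 0), ?_⟩
      · intro t t' htt
        have h1 := AddCircle.eq_of_coe_eq_of_abs_lt (Prod.mk.inj htt).1 (by
          rw [abs_lt]
          constructor <;> linarith [(hIcc t).1, (hIcc t).2, (hIcc t').1, (hIcc t').2])
        have h2 : (t : ℝ) * (b - a) = t' * (b - a) := by linarith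
        exact Subtype.ext (mul_right_cancel₀ (sub_pos.2 hab).ne' h2)
      · intro t
        have hba : b - a ≠ 0 := (sub_pos.2 hab).ne'
        rw [mem_C0]
        change φ (a + t * (b - a)) = 0 ↔ _
        rw [hφ0 _ (hIcc t)]
        refine or_congr ?_ ?_
        · rw [add_eq_left, mul_eq_zero, or_iff_left hba]
        · rw [← eq_sub_iff_add_eq', mul_eq_right₀ hba]
      · convert hcomp using 3
        rw [hfr]
        ext u
        constructor
        · rintro ⟨t, rfl⟩
          exact ⟨_, hIcc t, rfl⟩
        · rintro ⟨x, hx, rfl⟩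
          have hba : b - a ≠ 0 := (sub_pos.2 hab).ne'
          refine ⟨⟨(x - a) / (b - a), div_nonneg (by linarith [hx.1]) (by linarith),
            (div_le_one (by linarith)).2 (by linarith [hx.2])⟩, ?_⟩
          simp [div_mul_cancel₀ _ hba]
    · right
      let Φ : 𝕋 → Icc (0 : ℝ) 1 := AddCircle.liftIco 1 a φ
      have hΦc : Continuous Φ :=
        AddCircle.liftIco_continuous (hφa.trans hφb.symm) hφ.continuousOn
      have hΦ : ∀ x ∈ Icc a (a + 1), Φ x = φ x := by
        intro x hx
        rcases hx.2.lt_or_eq with hlt | rfl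
        · exact AddCircle.liftIco_coe_apply ⟨hx.1, hlt⟩
        · rw [AddCircle.coe_add_period, hφb, ← hφa]
          exact AddCircle.liftIco_coe_apply ⟨le_rfl, hab⟩
      let γ : C(𝕋, Ann) := ⟨fun θ => (θ, Φ θ), continuous_id.prodMk hΦc⟩
      have hrep : ∀ θ : 𝕋, ∃ x ∈ Icc a (a + 1), (x : 𝕋) = θ := by
        intro θ
        obtain ⟨x, hx, rfl⟩ := (AddCircle.coe_image_Icc_eq (1 : ℝ) a).ge (mem_univ θ)
        exact ⟨x, hx, rfl⟩
      have hrange : range γ = frontier (annProj '' Ω) := by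
        rw [hfr]
        ext u
        constructor
        · rintro ⟨θ, rfl⟩
          obtain ⟨x, hx, rfl⟩ := hrep θ
          exact ⟨x, hx, Prod.ext rfl (hΦ x hx).symm⟩
        · rintro ⟨x, hx, rfl⟩
          exact ⟨x, Prod.ext rfl (hΦ x hx)⟩
      refine ⟨frontier (annProj '' Ω), ⟨γ, fun θ θ' hθ => (Prod.mk.inj hθ).1, fun hnull => ?_,
        hrange⟩, ⟨annProj (a, 0), ⟨?_, mem_C0.2 rfl⟩, ?_⟩, _, hcomp⟩
      · exact circle_id_not_nullhomotopic (hnull.comp_right ContinuousMap.fst)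
      · rw [hfr]
        exact ⟨a, left_mem_Icc.2 hab.le, by simp only [hφa]⟩
      · rintro u ⟨hu, hu0⟩
        rw [hfr] at hu
        obtain ⟨x, hx, rfl⟩ := hu
        have hx0 : φ x = 0 := mem_C0.1 hu0
        rcases (hφ0 x hx).1 hx0 with rfl | rfl
        · simp only [hφa]
        · exact Prod.ext (AddCircle.coe_add_period 1 a) hφb
  · rintro θ u ⟨hu, huθ⟩ v ⟨hv, hvθ⟩
    rw [hfr] at hu hv
    obtain ⟨x, hx, rfl⟩ := hu
    obtain ⟨x', hx', rfl⟩ := hv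
    have hxx : (x : 𝕋) = x' := huθ.trans hvθ.symm
    by_cases hlt : |x - x'| < 1
    · rw [AddCircle.eq_of_coe_eq_of_abs_lt hxx hlt]
    · refine Prod.ext hxx ?_
      have hend : ∀ t ∈ Icc a b, ∀ t' ∈ Icc a b, 1 ≤ t - t' → φ t = φ t' := by
        intro t ht t' ht' h1
        have e1 : t = b := by linarith [ht.1, ht.2, ht'.1, ht'.2]
        have e2 : t' = a := by linarith [ht.1, ht.2, ht'.1, ht'.2]
        rw [e1, e2, hφa, hφb]
      rcases le_abs.1 (not_lt.1 hlt) with H | H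
      · exact hend x hx x' hx' H
      · exact (hend x' hx' x hx (by linarith)).symm

end TwistDisk

/-- A space all of whose circle-valued maps lift to `ℝ` cannot be embedded in `ℂ` as a punctured
neighbourhood of a point. -/
theorem HasCircleLifts.insert_range_notMem_nhds {S : Type*} [TopologicalSpace S]
    (hS : HasCircleLifts S) {E : S → ℂ} (hE : IsEmbedding E) {w : ℂ} (hw : w ∉ range E) :
    insert w (range E) ∉ 𝓝 w := by
  intro hn
  obtain ⟨r, hr, hball⟩ := Metric.nhds_basis_closedBall.mem_iff.1 hn
  have hne : ∀ s, E s - w ≠ 0 := fun s hs => hw ⟨s, sub_eq_zero.1 hs⟩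
  have hunit : ∀ s, (E s - w) / ‖E s - w‖ ∈ Submonoid.unitSphere ℂ := fun s =>
    mem_sphere_zero_iff_norm.2 (by simp [hne s])
  let ang : C(S, 𝕋) := ⟨fun s => (AddCircle.homeomorphCircle one_ne_zero).symm
      ⟨(E s - w) / ‖E s - w‖, hunit s⟩,
    (AddCircle.homeomorphCircle one_ne_zero).symm.continuous.comp <|
      ((hE.continuous.sub continuous_const).div
        (Complex.continuous_ofReal.comp (hE.continuous.sub continuous_const).norm)
        fun s => by simpa using hne s).subtype_mk _⟩
  obtain ⟨A, hA⟩ := hS ang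
  have hmem : ∀ t : 𝕋, w + r * (AddCircle.toCircle t : ℂ) ∈ range E := by
    intro t
    have h1 : w + r * (AddCircle.toCircle t : ℂ) ∈ Metric.closedBall w r := by
      rw [mem_closedBall_iff_norm, add_sub_cancel_left, norm_mul, Circle.norm_coe, mul_one,
        Complex.norm_real, Real.norm_of_nonneg hr.le]
    refine (hball h1).resolve_left fun h2 => ?_
    simp [hr.ne'] at h2
  choose c hc using hmem
  have hcc : Continuous c := by
    rw [hE.continuous_iff]
    have : E ∘ c = fun t : 𝕋 => w + r * (AddCircle.toCircle t : ℂ) := funext hc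
    rw [this]
    exact continuous_const.add (continuous_const.mul
      (continuous_subtype_val.comp AddCircle.continuous_toCircle))
  refine circle_no_section ⟨A.comp ⟨c, hcc⟩, fun t => ?_⟩
  change (A (c t) : 𝕋) = t
  rw [hA]
  refine (Homeomorph.symm_apply_eq _).2 ?_
  rw [AddCircle.homeomorphCircle_apply]
  refine Subtype.ext ?_
  change (E (c t) - w) / ‖E (c t) - w‖ = _
  rw [hc]
  have : (r : ℂ) ≠ 0 := Complex.ofReal_ne_zero.2 hr.ne'
  rw [add_sub_cancel_left, norm_mul, Circle.norm_coe, mul_one, Complex.norm_real,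
    Real.norm_of_nonneg hr.le, mul_div_cancel_left₀ _ this]

/-- A rectangle punctured at a point of its lower or upper side has lifts of circle-valued maps. -/
theorem hasCircleLifts_prod_diff_singleton {I J : Set ℝ} (hI : Convex ℝ I) (hJ : Convex ℝ J)
    {p : ℝ × ℝ} (hp : p.1 ∈ I) (hpJ : IsLeast J p.2 ∨ IsGreatest J p.2) (hJn : J.Nontrivial) :
    HasCircleLifts ↥((I ×ˢ J) \ {p}) := by
  obtain ⟨c, hcJ, hc⟩ := hJn.exists_ne p.2
  have hcM : (p.1, c) ∈ (I ×ˢ J) \ {p} :=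
    ⟨⟨hp, hcJ⟩, fun h => hc (congrArg Prod.snd (mem_singleton_iff.1 h))⟩
  have hM : Convex ℝ (I ×ˢ J) := hI.prod hJ
  have hstar : StarConvex ℝ (p.1, c) ((I ×ˢ J) \ {p}) := by
    intro q hq a b ha hb hab
    refine ⟨hM hcM.1 hq.1 ha hb hab, fun h => ?_⟩
    have h2 : a * c + b * q.2 = p.2 := congrArg Prod.snd (mem_singleton_iff.1 h)
    rcases ha.eq_or_lt with rfl | ha'
    · obtain rfl : b = 1 := by linarith
      refine hq.2 ?_
      simpa using h
    · have hq2 := hq.1.2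
      rcases hpJ with hl | hl
      · have h3 := lt_of_le_of_ne (hl.2 hcJ) hc.symm
        have h4 := hl.2 hq2
        nlinarith [mul_lt_mul_of_pos_left h3 ha', mul_le_mul_of_nonneg_left h4 hb,
          congrArg (· * p.2) hab]
      · have h3 := lt_of_le_of_ne (hl.2 hcJ) hc
        have h4 := hl.2 hq2
        nlinarith [mul_lt_mul_of_pos_left h3 ha', mul_le_mul_of_nonneg_left h4 hb,
          congrArg (· * p.2) hab]
  have := hstar.contractibleSpace ⟨_, hcM⟩
  have := hM.locallyPathConnectedSpace
  have : LocallyPathConnectedSpace ↥((I ×ˢ J) \ {p}) :=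
    (IsOpenEmbedding.inclusion (sdiff_subset (s := I ×ˢ J) (t := {p}))
      (by
        rw [preimage_sdiff, Subtype.coe_preimage_self]
        exact isOpen_univ.sdiff (isClosed_singleton.preimage
          continuous_subtype_val))).locallyPathConnectedSpace
  exact hasCircleLifts_of_simplyConnected _

/-- Invariance of the boundary: a space containing a half-box around `p` does not embed in the
plane as a neighbourhood of the image of `p`. -/
theorem range_notMem_nhds_of_halfBox {X : Type*} [TopologicalSpace X] {i e : X → ℝ × ℝ}
    (hi : IsEmbedding i) (he : IsEmbedding e) (p : X) {I J : Set ℝ} (hI : Convex ℝ I)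
    (hJ : Convex ℝ J) (hp : (i p).1 ∈ I) (hpJ : IsLeast J (i p).2 ∨ IsGreatest J (i p).2)
    (hJn : J.Nontrivial) (hIJ : I ×ˢ J ⊆ range i) (hn : i ⁻¹' (I ×ˢ J) ∈ 𝓝 p) :
    range e ∉ 𝓝 (e p) := by
  intro hr
  let S : Set X := i ⁻¹' ((I ×ˢ J) \ {i p})
  have hiS : IsEmbedding fun s : S => i s := hi.comp IsEmbedding.subtypeVal
  have hrange : range (fun s : S => i s) = (I ×ˢ J) \ {i p} := by
    rw [← Function.comp_def i, range_comp, Subtype.range_coe, image_preimage_eq_of_subset]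
    exact sdiff_subset.trans hIJ
  have hS : HasCircleLifts S := by
    have h1 := hasCircleLifts_prod_diff_singleton hI hJ hp hpJ hJn
    rw [← hrange] at h1
    exact h1.homeomorph hiS.toHomeomorph.symm
  let L : ℝ × ℝ ≃ₜ ℂ := Complex.equivRealProdCLM.symm.toHomeomorph
  refine hS.insert_range_notMem_nhds (E := fun s => L (e s)) (w := L (e p))
    (L.isEmbedding.comp (he.comp IsEmbedding.subtypeVal)) ?_ ?_
  · rintro ⟨s, hs⟩
    have := he.injective (L.injective hs)
    exact s.2.2 (congrArg i this)
  · rw [← L.map_nhds_eq, ← he.map_nhds_of_mem p hr]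
    refine mem_of_superset (image_mem_map (image_mem_map hn)) ?_
    rintro _ ⟨_, ⟨x, hx, rfl⟩, rfl⟩
    by_cases hxp : x = p
    · exact Or.inl (by rw [hxp])
    · exact Or.inr ⟨⟨x, hx, fun h => hxp (hi.injective h)⟩, rfl⟩

theorem hasCircleLifts_halfStrip : HasCircleLifts (ℝ × Ico (0 : ℝ) 1) := by
  have := (convex_Ico (0 : ℝ) 1).locallyPathConnectedSpace
  have := (convex_Ico (0 : ℝ) 1).contractibleSpace ⟨0, by simp⟩
  have : ContractibleSpace (ℝ × Ico (0 : ℝ) 1) := inferInstance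
  exact hasCircleLifts_of_simplyConnected _

/-- The projection of the strip to the annulus has a section over any open set on which
circle-valued maps lift. -/
theorem exists_lift_of_hasCircleLifts {U : Set Ann} (hU : IsOpen U) (hl : HasCircleLifts U) :
    ∃ Ω : Set StripA, IsOpen Ω ∧ InjOn annProj Ω ∧ annProj '' Ω = U ∧
      ∃ e : U ≃ₜ Ω, ∀ u, annProj (e u) = u := by
  obtain ⟨s, hs⟩ := hl ⟨fun u => u.1.1, continuous_fst.comp continuous_subtype_val⟩
  replace hs : ∀ u : U, (s u : 𝕋) = u.1.1 := hs
  let W : Set StripA := annProj ⁻¹' U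
  have hW : IsOpen W := hU.preimage continuous_annProj
  let d : W → ℝ := fun z => s ⟨annProj z, z.2⟩ - z.1.1
  have hd : Continuous d := (s.continuous.comp ((continuous_annProj.comp
    continuous_subtype_val).subtype_mk _)).sub (continuous_fst.comp continuous_subtype_val)
  have hd0 : {z : W | d z = 0} = {z : W | |d z| < 1} := by
    ext z
    refine ⟨fun h => ?_, fun h => ?_⟩
    · rw [mem_ofPred_eq] at h ⊢
      rw [h, abs_zero]
      exact one_pos
    · exact sub_eq_zero.2 (AddCircle.eq_of_coe_eq_of_abs_lt (hs _) h)
  let Ω : Set StripA := (↑) '' {z : W | d z = 0}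
  have hΩ : ∀ z, z ∈ Ω ↔ ∃ h : annProj z ∈ U, s ⟨annProj z, h⟩ = z.1 := by
    intro z
    constructor
    · rintro ⟨z, hz, rfl⟩
      exact ⟨z.2, sub_eq_zero.1 hz⟩
    · rintro ⟨h, hz⟩
      exact ⟨⟨z, h⟩, sub_eq_zero.2 hz, rfl⟩
  have hsU : ∀ u : U, annProj (s u, u.1.2) = u := fun u => Prod.ext (hs u) rfl
  have hsΩ : ∀ u : U, (s u, u.1.2) ∈ Ω := fun u =>
    (hΩ _).2 ⟨by rw [hsU]; exact u.2, congrArg s (Subtype.ext (hsU u))⟩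
  refine ⟨Ω, ?_, ?_, ?_, ⟨⟨fun u => ⟨_, hsΩ u⟩, fun z => ⟨annProj z, ((hΩ _).1 z.2).1⟩, fun u =>
    Subtype.ext (hsU u), fun z => ?_⟩, ?_, ?_⟩, hsU⟩
  · rw [show Ω = (↑) '' {z : W | |d z| < 1} from
      congrArg (fun A : Set W => ((↑) '' A : Set StripA)) hd0]
    exact hW.isOpenMap_subtype_val _ (isOpen_lt hd.abs continuous_const)
  · intro z hz w hw h
    obtain ⟨h1, h2⟩ := (hΩ z).1 hz
    obtain ⟨h3, h4⟩ := (hΩ w).1 hw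
    refine Prod.ext ?_ (Prod.mk.inj h).2
    rw [← h2, ← h4]
    exact congrArg s (Subtype.ext h)
  · ext u
    constructor
    · rintro ⟨z, hz, rfl⟩
      exact ((hΩ z).1 hz).1
    · exact fun hu => ⟨_, hsΩ ⟨u, hu⟩, hsU ⟨u, hu⟩⟩
  · exact Subtype.ext (Prod.ext ((hΩ _).1 z.2).2 rfl)
  · exact (s.continuous.prodMk (continuous_snd.comp continuous_subtype_val)).subtype_mk _
  · exact (continuous_annProj.comp continuous_subtype_val).subtype_mk _

theorem isEmbedding_halfStrip :
    IsEmbedding fun z : ℝ × Ico (0 : ℝ) 1 => (z.1, (z.2 : ℝ)) :=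
  IsEmbedding.id.prodMap IsEmbedding.subtypeVal

theorem isEmbedding_stripA : IsEmbedding fun z : StripA => (z.1, (z.2 : ℝ)) :=
  IsEmbedding.id.prodMap IsEmbedding.subtypeVal

/-- A homeomorphism from an open subset of the strip to `ℝ × [0, 1)` respects the boundaries. -/
theorem homeomorph_halfStrip_snd_eq_zero_iff {Ω : Set StripA} (hΩ : IsOpen Ω)
    (ψ : Ω ≃ₜ ℝ × Ico (0 : ℝ) 1) (z : Ω) :
    ((ψ z).2 : ℝ) = 0 ↔ ((z.1.2 : ℝ) = 0 ∨ (z.1.2 : ℝ) = 1) := by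
  have hi : IsEmbedding fun z : Ω => (z.1.1, (z.1.2 : ℝ)) :=
    isEmbedding_stripA.comp IsEmbedding.subtypeVal
  constructor
  · intro h0
    by_contra! hne
    have hz : (z.1.2 : ℝ) ∈ Ioo (0 : ℝ) 1 :=
      ⟨lt_of_le_of_ne z.1.2.2.1 hne.1.symm, lt_of_le_of_ne z.1.2.2.2 hne.2⟩
    refine range_notMem_nhds_of_halfBox isEmbedding_halfStrip (hi.comp ψ.symm.isEmbedding) (ψ z)
      convex_univ (convex_Ico (0 : ℝ) 1) (mem_univ _) (Or.inl ?_)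
      ((Ico_infinite one_pos).nontrivial) ?_ ?_ ?_
    · change IsLeast _ ((ψ z).2 : ℝ)
      rw [h0]
      exact isLeast_Ico one_pos
    · rintro ⟨x, y⟩ ⟨-, hy⟩
      exact ⟨(x, ⟨y, hy⟩), rfl⟩
    · exact Filter.univ_mem' fun w => ⟨mem_univ _, w.2.2⟩
    · rw [ψ.symm.surjective.range_comp]
      simp only [Function.comp_def, ψ.symm_apply_apply]
      have h1 : range (fun z : Ω => (z.1.1, (z.1.2 : ℝ))) =
          (fun z : StripA => (z.1, (z.2 : ℝ))) '' Ω := by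
        rw [← Function.comp_def (fun z : StripA => (z.1, (z.2 : ℝ))), range_comp,
          Subtype.range_coe]
      rw [h1, ← isEmbedding_stripA.map_nhds_of_mem z.1]
      · exact image_mem_map (hΩ.mem_nhds z.2)
      · refine mem_of_superset (prod_mem_nhds univ_mem (isOpen_Ioo.mem_nhds hz)) ?_
        rintro ⟨x, y⟩ ⟨-, hy⟩
        exact ⟨(x, ⟨y, Ioo_subset_Icc_self hy⟩), rfl⟩
  · intro hz
    by_contra hne
    have hpos : 0 < ((ψ z).2 : ℝ) := lt_of_le_of_ne (ψ z).2.2.1 (Ne.symm hne)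
    have h1 := isEmbedding_stripA.isInducing.nhds_eq_comap z.1 ▸ hΩ.mem_nhds z.2
    obtain ⟨V, hV, hVΩ⟩ := mem_comap.1 h1
    obtain ⟨r, hr, hball⟩ := Metric.mem_nhds_iff.1 hV
    rw [← ball_prod_same] at hball
    refine range_notMem_nhds_of_halfBox hi (isEmbedding_halfStrip.comp ψ.isEmbedding) z
      (convex_ball z.1.1 r) ((convex_ball (z.1.2 : ℝ) r).inter (convex_Icc (0 : ℝ) 1))
      (Metric.mem_ball_self hr) ?_ ?_ ?_ ?_ ?_
    · have hzJ : (z.1.2 : ℝ) ∈ Metric.ball (z.1.2 : ℝ) r ∩ Icc (0 : ℝ) 1 :=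
        ⟨Metric.mem_ball_self hr, z.1.2.2⟩
      rcases hz with h0 | h0
      · exact Or.inl ⟨hzJ, fun y hy => h0.trans_le hy.2.1⟩
      · exact Or.inr ⟨hzJ, fun y hy => hy.2.2.trans_eq h0.symm⟩
    · have hm := lt_min (half_pos hr) one_pos
      have hm₁ := min_le_left (r / 2) 1
      have hm₂ := min_le_right (r / 2) 1
      refine ⟨_, ⟨Metric.mem_ball_self hr, z.1.2.2⟩, ?_⟩
      rcases hz with h0 | h0
      · refine ⟨min (r / 2) 1, ⟨?_, hm.le, hm₂⟩, by rw [h0]; exact hm.ne⟩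
        rw [h0, Metric.mem_ball, Real.dist_eq, sub_zero, abs_of_pos hm]
        linarith
      · refine ⟨1 - min (r / 2) 1, ⟨?_, by linarith, by linarith⟩, by rw [h0]; linarith⟩
        rw [h0, Metric.mem_ball, Real.dist_eq, sub_sub_cancel_left, abs_neg, abs_of_pos hm]
        linarith
    · rintro ⟨x, y⟩ ⟨hx, hy⟩
      exact ⟨⟨(x, ⟨y, hy.2⟩), hVΩ (hball ⟨hx, hy.1⟩)⟩, rfl⟩
    · filter_upwards [hi.continuous.continuousAt.preimage_mem_nhds
        (prod_mem_nhds (Metric.ball_mem_nhds z.1.1 hr) (Metric.ball_mem_nhds (z.1.2 : ℝ) hr))]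
        with w hw
      exact ⟨hw.1, hw.2, w.1.2.2⟩
    · rw [ψ.surjective.range_comp]
      refine mem_of_superset (prod_mem_nhds univ_mem
        (isOpen_Ioo.mem_nhds (show ((ψ z).2 : ℝ) ∈ Ioo (0 : ℝ) 1 from ⟨hpos, (ψ z).2.2.2⟩))) ?_
      rintro ⟨x, y⟩ ⟨-, hy⟩
      exact ⟨(x, ⟨y, Ioo_subset_Ico_self hy⟩), rfl⟩

/-- The lift of a lower disk to the strip meets the boundary in a bounded open interval of the
lower side. -/
theorem exists_boundary_interval {Ω : Set StripA} (hΩ : IsOpen Ω)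
    (ψ : Ω ≃ₜ ℝ × Ico (0 : ℝ) 1) (hinj : InjOn annProj Ω) (hne : ∃ x, ((x, 0) : StripA) ∈ Ω) :
    ∃ a b : ℝ, a < b ∧ (∀ x, ((x, 0) : StripA) ∈ Ω ↔ x ∈ Ioo a b) ∧
      ∀ x, ((x, 1) : StripA) ∉ Ω := by
  let D : Set StripA := {z | z ∈ Ω ∧ ((z.2 : ℝ) = 0 ∨ (z.2 : ℝ) = 1)}
  have hD : IsPreconnected D := by
    have h1 : IsPreconnected ((univ : Set ℝ) ×ˢ ({⟨0, by simp⟩} : Set (Ico (0 : ℝ) 1))) :=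
      isPreconnected_univ.prod isPreconnected_singleton
    have h2 : D = (↑) '' (ψ ⁻¹' ((univ : Set ℝ) ×ˢ ({⟨0, by simp⟩} : Set (Ico (0 : ℝ) 1)))) := by
      ext z
      constructor
      · rintro ⟨hz, h⟩
        refine ⟨⟨z, hz⟩, ⟨mem_univ _, Subtype.ext ?_⟩, rfl⟩
        exact (homeomorph_halfStrip_snd_eq_zero_iff hΩ ψ ⟨z, hz⟩).2 h
      · rintro ⟨z, hz, rfl⟩
        exact ⟨z.2, (homeomorph_halfStrip_snd_eq_zero_iff hΩ ψ z).1 (congrArg Subtype.val hz.2)⟩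
    rw [h2]
    exact (ψ.isPreconnected_preimage.2 h1).image _ continuous_subtype_val.continuousOn
  obtain ⟨x₀, hx₀⟩ := hne
  have htop : ∀ x, ((x, 1) : StripA) ∉ Ω := by
    intro x hx
    have hoc := (hD.image (fun z => (z.2 : ℝ)) (by fun_prop)).ordConnected
    obtain ⟨z, hz, hz'⟩ := hoc.out (x := 0) (y := 1) ⟨_, ⟨hx₀, Or.inl rfl⟩, rfl⟩
      ⟨_, ⟨hx, Or.inr rfl⟩, rfl⟩ (show (1 / 2 : ℝ) ∈ Icc (0 : ℝ) 1 by constructor <;> norm_num)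
    replace hz' : (z.2 : ℝ) = 1 / 2 := hz'
    rcases hz.2 with h | h <;> rw [h] at hz' <;> norm_num at hz'
  let B : Set ℝ := {x | ((x, 0) : StripA) ∈ Ω}
  have hBo : IsOpen B := hΩ.preimage (by fun_prop)
  have hBc : IsPreconnected B := by
    have h1 : B = Prod.fst '' D := by
      ext x
      constructor
      · exact fun hx => ⟨_, ⟨hx, Or.inl rfl⟩, rfl⟩
      · rintro ⟨⟨x, y⟩, ⟨hz, h | h⟩, rfl⟩
        · obtain rfl : y = 0 := Subtype.ext h
          exact hz
        · obtain rfl : y = 1 := Subtype.ext h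
          exact absurd hz (htop x)
    rw [h1]
    exact hD.image _ continuous_fst.continuousOn
  have hlen : ∀ x ∈ B, ∀ y ∈ B, y < x + 1 := by
    intro x hx y hy
    by_contra! hxy
    have hx' : x + 1 ∈ B := hBc.ordConnected.out hx hy ⟨by linarith, hxy⟩
    have := (Prod.mk.inj (hinj hx hx' (by simp [annProj]))).1
    linarith
  have hBa : BddAbove B := ⟨x₀ + 1, fun y hy => (hlen x₀ hx₀ y hy).le⟩
  have hBb : BddBelow B := ⟨x₀ - 1, fun y hy => by linarith [hlen y hy x₀ hx₀]⟩
  have hB : B = Ioo (sInf B) (sSup B) := by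
    refine Subset.antisymm ?_ (IsConnected.Ioo_csInf_csSup_subset ⟨⟨x₀, hx₀⟩, hBc⟩ hBb hBa)
    rw [← interior_Icc]
    exact interior_maximal (subset_Icc_csInf_csSup hBb hBa) hBo
  have hx₀' : x₀ ∈ Ioo (sInf B) (sSup B) := hB ▸ hx₀
  exact ⟨sInf B, sSup B, hx₀'.1.trans hx₀'.2, fun x => Set.ext_iff.1 hB x, htop⟩

theorem isOpenMap_annProj : IsOpenMap annProj :=
  IsOpenMap.prodMap QuotientAddGroup.isOpenMap_coe IsOpenMap.id

theorem AnnulusHomeo.iter_natCast (h : AnnulusHomeo) (n : ℕ) : h.iter n = h.toFun^[n] := by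
  ext1 z
  rw [iter, zpow_natCast, ← Equiv.Perm.iterate_eq_pow]
  rfl

namespace AnnulusHomeo

variable (h : AnnulusHomeo)

theorem lift_add_int (z : StripA) (n : ℤ) :
    h.lift (z.1 + n, z.2) = ((h.lift z).1 + n, (h.lift z).2) := by
  have hstep : ∀ w : StripA, h.lift (w.1 + 1, w.2) = ((h.lift w).1 + 1, (h.lift w).2) :=
    h.lift_deck
  induction n using Int.induction_on with
  | zero => simp
  | succ n ih =>
    have := hstep (z.1 + (n : ℤ), z.2)
    rw [ih] at this
    push_cast at this ⊢
    simpa only [add_assoc] using this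
  | pred n ih =>
    have := hstep (z.1 + ((-n - 1 : ℤ) : ℝ), z.2)
    have h1 : z.1 + ((-n - 1 : ℤ) : ℝ) + 1 = z.1 + ((-n : ℤ) : ℝ) := by push_cast; ring
    dsimp only at this
    rw [h1, ih, Prod.mk.injEq] at this
    refine Prod.ext ?_ this.2.symm
    have h2 := this.1
    push_cast at h2 ⊢
    linarith

theorem lift_bot (x : ℝ) : h.lift (x, 0) = ((h.lift (x, 0)).1, 0) :=
  Prod.ext rfl (Subtype.ext (h.lift_bd0 (x, 0) rfl))

theorem continuous_lift_bot : Continuous fun x : ℝ => (h.lift (x, 0)).1 :=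
  continuous_fst.comp (h.lift.continuous.comp (by fun_prop))

theorem strictMono_lift_bot : StrictMono fun x : ℝ => (h.lift (x, 0)).1 := by
  have hinj : Function.Injective fun x : ℝ => (h.lift (x, 0)).1 := by
    intro x x' hx
    have h1 : h.lift (x, 0) = h.lift (x', 0) := by
      rw [h.lift_bot x, h.lift_bot x']
      exact Prod.ext hx rfl
    exact (Prod.mk.inj (h.lift.injective h1)).1
  refine (h.continuous_lift_bot.strictMono_of_inj hinj).resolve_right fun hanti => ?_
  have h1 := hanti zero_lt_one
  have h2 := congrArg Prod.fst (h.lift_deck (0, 0))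
  simp only [deckT, zero_add] at h2
  dsimp only at h1
  linarith

theorem surjective_lift_bot : Function.Surjective fun x : ℝ => (h.lift (x, 0)).1 := by
  intro y
  obtain ⟨n, hn⟩ := exists_int_gt (y - (h.lift (0, 0)).1)
  obtain ⟨m, hm⟩ := exists_int_lt (y - (h.lift (0, 0)).1)
  have hval : ∀ n : ℤ, (h.lift ((n : ℝ), 0)).1 = (h.lift (0, 0)).1 + n := by
    intro n
    have := congrArg Prod.fst (h.lift_add_int (0, 0) n)
    simpa only [zero_add] using this
  refine (isPreconnected_range h.continuous_lift_bot).ordConnected.out ⟨(m : ℝ), rfl⟩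
    ⟨(n : ℝ), rfl⟩ ⟨?_, ?_⟩ <;> dsimp only <;> rw [hval] <;> linarith

theorem lift_snd_eq_zero_iff (z : StripA) : (h.lift z).2 = 0 ↔ z.2 = 0 := by
  constructor
  · intro hz
    obtain ⟨x, hx⟩ := h.surjective_lift_bot (h.lift z).1
    have h1 : h.lift (x, 0) = h.lift z := by
      rw [h.lift_bot x]
      exact Prod.ext hx hz.symm
    rw [← h.lift.injective h1]
  · exact fun hz => Subtype.ext (h.lift_bd0 z (congrArg Subtype.val hz))

/-- The lift of an annulus homeomorphism translated by an integer. -/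
noncomputable def shiftLift (k : ℤ) : StripA ≃ₜ StripA :=
  h.lift.trans ((Homeomorph.addRight (k : ℝ)).prodCongr (Homeomorph.refl _))

theorem shiftLift_apply (k : ℤ) (z : StripA) :
    h.shiftLift k z = ((h.lift z).1 + k, (h.lift z).2) := rfl

theorem annProj_shiftLift (k : ℤ) (z : StripA) :
    annProj (h.shiftLift k z) = h.toFun (annProj z) := by
  rw [← h.lift_proj, shiftLift_apply]
  refine Prod.ext ?_ rfl
  change (((h.lift z).1 + (k : ℝ) : ℝ) : 𝕋) = ((h.lift z).1 : 𝕋)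
  rw [AddCircle.coe_add, add_eq_left, AddCircle.coe_eq_zero_iff]
  exact ⟨k, by simp⟩

/-- An invariant set with a connected lift `Ω` has some translate of the lifted homeomorphism
leaving `Ω` invariant. -/
theorem exists_shiftLift_preimage_eq {U : Set Ann} (hU : h.toFun '' U = U) {Ω : Set StripA}
    (hinj : InjOn annProj Ω) (himg : annProj '' Ω = U) (hc : IsPreconnected Ω) (e : U ≃ₜ Ω)
    (he : ∀ u, annProj (e u) = u) : ∃ k : ℤ, h.shiftLift k ⁻¹' Ω = Ω := by
  have hmem : ∀ z : Ω, annProj (h.lift z) ∈ U := by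
    intro z
    rw [h.lift_proj, ← hU]
    exact mem_image_of_mem _ (himg ▸ mem_image_of_mem _ z.2)
  let d : Ω → ℝ := fun z => (e ⟨annProj (h.lift z), hmem z⟩).1.1 - (h.lift z).1
  have hd : Continuous d := by
    have h1 : Continuous fun z : Ω => h.lift z := h.lift.continuous.comp continuous_subtype_val
    exact (continuous_fst.comp (continuous_subtype_val.comp (e.continuous.comp
      ((continuous_annProj.comp h1).subtype_mk _)))).sub (continuous_fst.comp h1)
  have hd0 : ∀ z, ((d z : ℝ) : 𝕋) = 0 := by
    intro z
    rw [AddCircle.coe_sub, sub_eq_zero]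
    exact (Prod.mk.inj (he ⟨annProj (h.lift z), hmem z⟩)).1
  have := isPreconnected_iff_preconnectedSpace.1 hc
  rcases Ω.eq_empty_or_nonempty with rfl | ⟨z₀, hz₀⟩
  · exact ⟨0, preimage_empty⟩
  obtain ⟨k, hk⟩ := (AddCircle.coe_eq_zero_iff (1 : ℝ)).1 (hd0 ⟨z₀, hz₀⟩)
  have hdk : ∀ z, d z = k := by
    intro z
    rw [isPreconnected_univ.eq_of_circle_eq_zero hd.continuousOn (fun z _ => hd0 z) (mem_univ z)
      (mem_univ ⟨z₀, hz₀⟩), ← hk]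
    simp
  have hmaps : ∀ z ∈ Ω, h.shiftLift k z ∈ Ω := by
    intro z hz
    have h1 : h.shiftLift k z = e ⟨annProj (h.lift z), hmem ⟨z, hz⟩⟩ := by
      rw [shiftLift_apply]
      refine Prod.ext ?_ ?_
      · rw [← hdk ⟨z, hz⟩]
        exact add_sub_cancel _ _
      · exact (Prod.mk.inj (he ⟨annProj (h.lift z), hmem ⟨z, hz⟩⟩)).2.symm
    rw [h1]
    exact (e _).2
  refine ⟨k, Subset.antisymm (fun z hz => ?_) hmaps⟩
  have h1 : h.toFun (annProj z) ∈ h.toFun '' U := by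
    rw [hU, ← h.annProj_shiftLift k, ← himg]
    exact mem_image_of_mem _ hz
  rw [h.toFun.injective.mem_set_image, ← himg] at h1
  obtain ⟨w, hw, hwz⟩ := h1
  have h2 : h.shiftLift k w = h.shiftLift k z :=
    hinj (hmaps w hw) hz (by rw [annProj_shiftLift, annProj_shiftLift, hwz])
  exact (h.shiftLift k).injective h2 ▸ hw

theorem nonwandering_shiftLift (hnw : NonWandering h) {Ω : Set StripA} (hinj : InjOn annProj Ω)
    {k : ℤ} (hk : h.shiftLift k ⁻¹' Ω = Ω) {N : Set StripA} (hN : N ⊆ Ω) (hNo : IsOpen N)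
    (hne : N.Nonempty) : ∃ n : ℕ, 0 < n ∧ ∃ z ∈ N, (h.shiftLift k)^[n] z ∈ N := by
  obtain ⟨n, hn, _, ⟨_, ⟨z, hz, rfl⟩, rfl⟩, w, hw, hwz⟩ :=
    hnw _ (isOpenMap_annProj _ hNo) (hne.image _)
  have hsemi : Function.Semiconj annProj (h.shiftLift k) h.toFun := h.annProj_shiftLift k
  rw [h.iter_natCast, ← (hsemi.iterate_right n).eq] at hwz
  have hmaps : MapsTo (h.shiftLift k) Ω Ω := fun z hz => by rwa [← hk] at hz
  exact ⟨n, hn, z, hz, hinj (hN hw) (hmaps.iterate n (hN hz)) hwz ▸ hw⟩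

end AnnulusHomeo

theorem PositiveTwistMap.strictMono_lift_vertical (f : PositiveTwistMap) (x : ℝ) :
    StrictMono fun y => (f.lift (x, y)).1 := by
  have hstrip : ∀ t ∈ Icc (0 : ℝ) 1, ((x, t) : ℝ × ℝ) ∈ stripS := fun t ht => ht
  have hderiv : ∀ t ∈ Icc (0 : ℝ) 1, HasDerivWithinAt (fun t => (f.F (x, t)).1)
      (f.F' (x, t) (0, 1)).1 (Icc 0 1) t := by
    intro t ht
    have h1 : HasDerivWithinAt (fun t : ℝ => ((x, t) : ℝ × ℝ)) (0, 1) (Icc 0 1) t :=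
      (hasDerivWithinAt_const t _ x).prodMk (hasDerivWithinAt_id t _)
    have h2 := (f.F_hasDeriv _ (hstrip t ht)).comp_hasDerivWithinAt t h1 hstrip
    exact (ContinuousLinearMap.fst ℝ ℝ ℝ).hasFDerivAt.comp_hasDerivWithinAt t h2
  have hmono : StrictMonoOn (fun t => (f.F (x, t)).1) (Icc 0 1) :=
    strictMonoOn_of_hasDerivWithinAt_pos (convex_Icc 0 1)
      (fun t ht => (hderiv t ht).continuousWithinAt)
      (fun t ht => (hderiv t (interior_subset ht)).mono interior_subset)
      (fun t ht => f.twist_pos _ (hstrip t (interior_subset ht)))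
  intro y y' hy
  have h1 := hmono y.2 y'.2 hy
  have h2 := f.F_lift (x, y)
  have h3 := f.F_lift (x, y')
  dsimp only at h1 h2 h3 ⊢
  rwa [h2, h3] at h1

/-- An invariant lower disk of a non wandering positive twist map is regular and its
frontier meets each vertical segment in at most one point. -/
theorem statement6 (f : PositiveTwistMap) (hnw : NonWandering f.toAnnulusHomeo)
    (U : Set Ann) (hU : IsLowerDisk U) (hUinv : f.toFun '' U = U) :
    IsRegularLowerDisk U ∧
      ∀ x : 𝕋, Set.Subsingleton {z : Ann | z ∈ frontier U ∧ z.1 = x} := by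
  obtain ⟨hUo, ⟨ψ⟩, u, hu, hu0⟩ := hU
  obtain ⟨Ω, hΩ, hinj, himg, e, he⟩ :=
    exists_lift_of_hasCircleLifts hUo (hasCircleLifts_halfStrip.homeomorph ψ.symm)
  let χ : Ω ≃ₜ ℝ × Ico (0 : ℝ) 1 := e.symm.trans ψ
  have hne : ∃ x, ((x, 0) : StripA) ∈ Ω := by
    refine ⟨(e ⟨u, hu⟩).1.1, ?_⟩
    have h2 : (0 : Icc (0 : ℝ) 1) = (e ⟨u, hu⟩).1.2 :=
      (mem_C0.1 hu0).symm.trans (Prod.mk.inj (he ⟨u, hu⟩)).2.symm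
    rw [h2]
    exact (e ⟨u, hu⟩).2
  obtain ⟨a, b, hab, hbot, htop⟩ := exists_boundary_interval hΩ χ hinj hne
  have hconn : IsPreconnected Ω := by
    have := convex_Ico (0 : ℝ) 1 |>.isPreconnected
    have := isPreconnected_iff_preconnectedSpace.1 this
    have h1 := χ.isPreconnected_preimage.2 isPreconnected_univ
    have h2 := h1.image _ continuous_subtype_val.continuousOn
    rwa [preimage_univ, image_univ, Subtype.range_coe] at h2
  obtain ⟨k, hk⟩ := f.exists_shiftLift_preimage_eq hUinv hinj himg hconn e he
  have htd : TwistDisk (f.shiftLift k) Ω a b :=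
    { bot := f.lift_snd_eq_zero_iff
      twist := fun x => (f.strictMono_lift_vertical x).add_const (k : ℝ)
      mono := f.strictMono_lift_bot.add_const (k : ℝ)
      lt := hab
      isOpen := hΩ
      conn := hconn
      unicoh := hasCircleLifts_halfStrip.isUnicoherent.homeomorph χ.symm
      inv := hk
      bottom := hbot
      top := htop
      nw := fun N hN hNo hNne => f.nonwandering_shiftLift hnw hinj hk hN hNo hNne }
  rw [← himg] at hUo ⊢
  exact htd.conclusion hinj hUo
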